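/- arXiv:1510.08086 — 3 statements merged into one kernel-verified Lean document; each statement's English description precedes it below -/
import Mathlib

section
/- Let s = σ+it with σ > 1 and t ∈ ℝ. Then Re{Γ′/Γ(s)} ≤ log|s| + σ^{−1}, and for any Hecke character χ, Re{γ_χ′/γ_χ(s)} ≤ (n_K/2)( log(|s|+1) + σ^{−1} − log π ). -/
open scoped BigOperators
open Complex NumberField Filter Topology

noncomputable section

namespace RTZ

/-- The degree `n_K = [K : ℚ]` of a number field. -/
def nK (K : Type*) [Field K] [NumberField K] : ℕ := Module.finrank ℚ K

/-- The absolute value `D_K` of the discriminant of `K`. -/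
def DK (K : Type*) [Field K] [NumberField K] : ℕ := (NumberField.discr K).natAbs

/-- An algebraic integer is totally positive if it is positive under every real embedding. -/
def TotPos (K : Type*) [Field K] [NumberField K] (α : 𝓞 K) : Prop :=
  ∀ φ : K →+* ℝ, 0 < φ (algebraMap (𝓞 K) K α)

/-- A Hecke (narrow ray class) character modulo `𝔮`, regarded as a function on integral
ideals extended by zero: it is completely multiplicative, vanishes on ideals not coprime
to `𝔮`, has modulus one on ideals coprime to `𝔮`, and is trivial on principal ideals
generated by totally positive elements `α ≡ 1 (mod 𝔮)`. -/
structure HeckeChar (K : Type*) [Field K] [NumberField K] (𝔮 : Ideal (𝓞 K)) where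
  toFun : Ideal (𝓞 K) → ℂ
  map_mul' : ∀ 𝔞 𝔟 : Ideal (𝓞 K), toFun (𝔞 * 𝔟) = toFun 𝔞 * toFun 𝔟
  eq_zero' : ∀ 𝔞 : Ideal (𝓞 K), ¬ IsCoprime 𝔞 𝔮 → toFun 𝔞 = 0
  norm_one' : ∀ 𝔞 : Ideal (𝓞 K), IsCoprime 𝔞 𝔮 → ‖toFun 𝔞‖ = 1
  ray_one' : ∀ α : 𝓞 K, TotPos K α → α - 1 ∈ 𝔮 → toFun (Ideal.span {α}) = 1

variable {K : Type*} [Field K] [NumberField K]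

/-- The trivial (principal) Hecke character condition. -/
def IsTrivialChar {𝔮 : Ideal (𝓞 K)} (χ : HeckeChar K 𝔮) : Prop :=
  ∀ 𝔞, IsCoprime 𝔞 𝔮 → χ.toFun 𝔞 = 1

open scoped Classical in
/-- `δ(χ)`: the indicator of the trivial character. -/
def delta {𝔮 : Ideal (𝓞 K)} (χ : HeckeChar K 𝔮) : ℝ :=
  if IsTrivialChar χ then 1 else 0

/-- `χ' (mod 𝔣)` induces `χ (mod 𝔮)`: `𝔣 ∣ 𝔮` and the two characters agree on ideals
coprime to `𝔮`. -/
def Induces {𝔣 𝔮 : Ideal (𝓞 K)} (χ' : HeckeChar K 𝔣) (χ : HeckeChar K 𝔮) : Prop :=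
  𝔮 ≤ 𝔣 ∧ ∀ 𝔞, IsCoprime 𝔞 𝔮 → χ.toFun 𝔞 = χ'.toFun 𝔞

/-- `𝔣` is the conductor `𝔣_χ` of `χ`: `χ` is induced from a character mod `𝔣`, and `𝔣`
divides every modulus from which `χ` is induced. -/
def IsConductor {𝔮 : Ideal (𝓞 K)} (χ : HeckeChar K 𝔮) (𝔣 : Ideal (𝓞 K)) : Prop :=
  (∃ χ' : HeckeChar K 𝔣, Induces χ' χ) ∧
    ∀ 𝔣' : Ideal (𝓞 K), (∃ χ' : HeckeChar K 𝔣', Induces χ' χ) → 𝔣' ≤ 𝔣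

/-- A Hecke character is primitive if its conductor equals its modulus. -/
def IsPrimitiveChar {𝔮 : Ideal (𝓞 K)} (χ : HeckeChar K 𝔮) : Prop := IsConductor χ 𝔮

/-- Two integral ideals lie in the same narrow ray class mod `𝔮`: `(α)𝔞 = (β)𝔟` for some
totally positive `α, β ≡ 1 (mod 𝔮)`. -/
def rayEquiv (𝔮 𝔞 𝔟 : Ideal (𝓞 K)) : Prop :=
  ∃ α β : 𝓞 K, TotPos K α ∧ TotPos K β ∧ α - 1 ∈ 𝔮 ∧ β - 1 ∈ 𝔮 ∧
    Ideal.span {α} * 𝔞 = Ideal.span {β} * 𝔟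

/-- A congruence class group `H (mod 𝔮)`: a subgroup of `I(𝔮)` containing `P_𝔮`, described
by the set of integral ideals whose narrow ray class lies in the subgroup. -/
structure CongClassGroup (K : Type*) [Field K] [NumberField K] (𝔮 : Ideal (𝓞 K)) where
  mem : Ideal (𝓞 K) → Prop
  coprime' : ∀ 𝔞, mem 𝔞 → IsCoprime 𝔞 𝔮
  princ_mem' : ∀ α : 𝓞 K, TotPos K α → α - 1 ∈ 𝔮 → mem (Ideal.span {α})
  mul_mem' : ∀ 𝔞 𝔟, mem 𝔞 → mem 𝔟 → mem (𝔞 * 𝔟)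
  class_mem' : ∀ 𝔞 𝔟, IsCoprime 𝔟 𝔮 → rayEquiv 𝔮 𝔞 𝔟 → mem 𝔞 → mem 𝔟

/-- `χ(H) = 1`: the character is trivial on the congruence class group `H`. -/
def CharTrivOn {𝔮 : Ideal (𝓞 K)} (χ : HeckeChar K 𝔮) (H : CongClassGroup K 𝔮) : Prop :=
  ∀ 𝔞, H.mem 𝔞 → χ.toFun 𝔞 = 1

/-- The coset of `H` in `I(𝔮)` determined by an integral ideal `𝔞₀`. -/
def coset {𝔮 : Ideal (𝓞 K)} (H : CongClassGroup K 𝔮) (𝔞₀ : Ideal (𝓞 K)) :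
    Set (Ideal (𝓞 K)) :=
  {𝔞 | ∃ 𝔥, H.mem 𝔥 ∧ rayEquiv 𝔮 (𝔞₀ * 𝔥) 𝔞}

/-- `h_H = [I(𝔮) : H]`, the number of cosets of `H`. -/
def hH {𝔮 : Ideal (𝓞 K)} (H : CongClassGroup K 𝔮) : ℕ :=
  Nat.card {C : Set (Ideal (𝓞 K)) // ∃ 𝔞₀, IsCoprime 𝔞₀ 𝔮 ∧ C = coset H 𝔞₀}

/-- `Q = Q_H = max { N𝔣_χ : χ (mod 𝔮), χ(H) = 1 }`. -/
def QH {𝔮 : Ideal (𝓞 K)} (H : CongClassGroup K 𝔮) : ℕ :=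
  sSup {n | ∃ (χ : HeckeChar K 𝔮) (𝔣 : Ideal (𝓞 K)),
    CharTrivOn χ H ∧ IsConductor χ 𝔣 ∧ n = Ideal.absNorm 𝔣}

/-- `𝔣_H = lcm { 𝔣_χ : χ(H) = 1 }` (the lcm of ideals is their infimum). -/
def fH {𝔮 : Ideal (𝓞 K)} (H : CongClassGroup K 𝔮) : Ideal (𝓞 K) :=
  sInf {𝔣 | ∃ χ : HeckeChar K 𝔮, CharTrivOn χ H ∧ IsConductor χ 𝔣}

/-- A congruence class group `H (mod 𝔮)` is primitive if `𝔮 = 𝔣_H`. -/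
def IsPrimitiveCCG {𝔮 : Ideal (𝓞 K)} (H : CongClassGroup K 𝔮) : Prop := 𝔮 = fH H

/-- The Dirichlet series `Σ_𝔫 χ(𝔫) N𝔫^{-s}` of a Hecke character. -/
def LSer {𝔮 : Ideal (𝓞 K)} (χ : HeckeChar K 𝔮) (s : ℂ) : ℂ :=
  ∑' 𝔞 : {I : Ideal (𝓞 K) // I ≠ ⊥}, χ.toFun 𝔞.1 * (Ideal.absNorm 𝔞.1 : ℂ) ^ (-s)

/-- `L` is "the" Hecke `L`-function of `χ`: analytic away from `s = 1` and given by the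
Dirichlet series on `Re s > 1` (this determines `L` away from `s = 1`). -/
def IsLFun {𝔮 : Ideal (𝓞 K)} (χ : HeckeChar K 𝔮) (L : ℂ → ℂ) : Prop :=
  (∀ s : ℂ, s ≠ 1 → DifferentiableAt ℂ L s) ∧ ∀ s : ℂ, 1 < s.re → L s = LSer χ s

/-- The Dedekind zeta series of `K`. -/
def zetaSer (K : Type*) [Field K] [NumberField K] (s : ℂ) : ℂ :=
  ∑' 𝔞 : {I : Ideal (𝓞 K) // I ≠ ⊥}, (Ideal.absNorm 𝔞.1 : ℂ) ^ (-s)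

/-- `Z` is "the" Dedekind zeta function of `K`. -/
def IsZetaFun (K : Type*) [Field K] [NumberField K] (Z : ℂ → ℂ) : Prop :=
  (∀ s : ℂ, s ≠ 1 → DifferentiableAt ℂ Z s) ∧ ∀ s : ℂ, 1 < s.re → Z s = zetaSer K s

/-- `L` vanishes at `ρ` to order at least `m`. -/
def ZeroOrderAtLeast (L : ℂ → ℂ) (ρ : ℂ) (m : ℕ) : Prop :=
  ∃ g : ℂ → ℂ, AnalyticAt ℂ g ρ ∧ ∀ᶠ z in nhds ρ, L z = (z - ρ) ^ m * g z

/-- `L` vanishes at `ρ` to order exactly `m`. -/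
def ZeroOrderExact (L : ℂ → ℂ) (ρ : ℂ) (m : ℕ) : Prop :=
  ∃ g : ℂ → ℂ, AnalyticAt ℂ g ρ ∧ g ρ ≠ 0 ∧ ∀ᶠ z in nhds ρ, L z = (z - ρ) ^ m * g z

open scoped Classical in
/-- The von Mangoldt function `Λ_K` of the field `K`. -/
def ΛK (K : Type*) [Field K] [NumberField K] (𝔫 : Ideal (𝓞 K)) : ℝ :=
  if h : ∃ (𝔭 : Ideal (𝓞 K)) (k : ℕ), 𝔭.IsPrime ∧ 𝔭 ≠ ⊥ ∧ 1 ≤ k ∧ 𝔫 = 𝔭 ^ k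
  then Real.log (Ideal.absNorm h.choose) else 0

/-- The residue `κ_K` of `ζ_K` at `s = 1`, characterized as a limit of the real Dirichlet
series. -/
def IsResidue (K : Type*) [Field K] [NumberField K] (κ : ℝ) : Prop :=
  Filter.Tendsto (fun σ : ℝ => (σ - 1) *
      ∑' 𝔞 : {I : Ideal (𝓞 K) // I ≠ ⊥}, (Ideal.absNorm 𝔞.1 : ℝ) ^ (-σ))
    (nhdsWithin 1 (Set.Ioi 1)) (nhds κ)

/-- `γ_K`, the Euler–Kronecker constant: `ζ_K(s) - κ_K/(s-1) → κ_K γ_K` as `s → 1⁺`. -/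
def IsEulerKronecker (K : Type*) [Field K] [NumberField K] (κ γK : ℝ) : Prop :=
  Filter.Tendsto (fun σ : ℝ =>
      (∑' 𝔞 : {I : Ideal (𝓞 K) // I ≠ ⊥}, (Ideal.absNorm 𝔞.1 : ℝ) ^ (-σ)) - κ / (σ - 1))
    (nhdsWithin 1 (Set.Ioi 1)) (nhds (κ * γK))

/-- The gamma factor `γ_χ(s) = [π^{-s/2} Γ(s/2)]^{a(χ)} [π^{-(s+1)/2} Γ((s+1)/2)]^{b(χ)}`. -/
def gammaFactor (a b : ℕ) (s : ℂ) : ℂ :=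
  ((Real.pi : ℂ) ^ (-s / 2) * Complex.Gamma (s / 2)) ^ a *
    ((Real.pi : ℂ) ^ (-(s + 1) / 2) * Complex.Gamma ((s + 1) / 2)) ^ b

/-- The derivative of `log ‖f‖` along a horizontal line is the real part of `f' / f`. -/
lemma hasDerivAt_log_norm_horizontal {f : ℂ → ℂ} {x y : ℝ}
    (hf : DifferentiableAt ℂ f (x + y * I)) (h0 : f (x + y * I) ≠ 0) :
    HasDerivAt (fun u : ℝ => Real.log ‖f (u + y * I)‖) (logDeriv f (x + y * I)).re x := by
  have h1 : HasDerivAt (fun w : ℂ => f (w + y * I)) (deriv f (x + y * I)) (x : ℂ) :=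
    hf.hasDerivAt.comp_add_const (x : ℂ) (y * I)
  have h2 := h1.comp_ofReal.norm_sq
  have h3 := (h2.log (by positivity)).const_mul (1 / 2 : ℝ)
  convert! h3 using 1
  · ext u
    simp only [Real.log_pow]
    push_cast
    ring
  · rw [logDeriv_apply, Complex.inner, Complex.div_re, ← Complex.normSq_eq_norm_sq]
    have : Complex.normSq (f (x + y * I)) ≠ 0 := by simpa using h0
    simp only [Complex.mul_re, Complex.conj_re, Complex.conj_im]
    field_simp
    ring

lemma ne_zero_of_zero_lt_re {z : ℂ} (hz : 0 < z.re) : z ≠ 0 := by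
  rintro rfl
  simp at hz

lemma ne_neg_nat_of_re_pos {z : ℂ} (hz : 0 < z.re) (m : ℕ) : z ≠ -m := by
  rintro rfl
  simp only [neg_re, natCast_re] at hz
  linarith [Nat.cast_nonneg (α := ℝ) m]

lemma concaveOn_log_norm_horizontal (y : ℝ) :
    ConcaveOn ℝ (Set.Ioi |y|) (fun u : ℝ => Real.log ‖(u + y * I : ℂ)‖) := by
  have hd : ∀ u ∈ Set.Ioi |y|, HasDerivAt (fun u : ℝ => Real.log ‖(u + y * I : ℂ)‖)
      (u / (u ^ 2 + y ^ 2)) u := by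
    intro u hu
    have hu0 : 0 < u := (abs_nonneg y).trans_lt hu
    have h := hasDerivAt_log_norm_horizontal (f := fun w => w) (x := u) (y := y)
      differentiableAt_id (ne_zero_of_zero_lt_re (by simpa using hu0))
    convert! h using 1
    rw [logDeriv_id', Complex.div_re, Complex.normSq_apply]
    simp [pow_two]
  refine AntitoneOn.concaveOn_of_deriv (convex_Ioi _)
    (fun u hu => (hd u hu).continuousAt.continuousWithinAt)
    (fun u hu => (hd u (interior_subset hu)).differentiableAt.differentiableWithinAt) ?_
  rw [interior_Ioi]
  intro u hu v hv huv
  rw [(hd u hu).deriv, (hd v hv).deriv]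
  have hu' : |y| < u := hu
  have hu0 : 0 < u := (abs_nonneg y).trans_lt hu
  have hv0 : 0 < v := hu0.trans_le huv
  have hy : y ^ 2 ≤ u ^ 2 := sq_le_sq' (by linarith [neg_abs_le y]) (by linarith [le_abs_self y])
  have huv' : y ^ 2 ≤ u * v := by nlinarith
  rw [div_le_div_iff₀ (by positivity) (by positivity)]
  nlinarith [mul_nonneg (sub_nonneg.2 huv) (sub_nonneg.2 huv')]

lemma log_norm_GammaSeq {z : ℂ} (hz : 0 < z.re) {n : ℕ} (hn : n ≠ 0) :
    Real.log ‖GammaSeq z n‖ = z.re * Real.log n + Real.log n.factorial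
      - ∑ j ∈ Finset.range (n + 1), Real.log ‖z + j‖ := by
  have hn0 : (0 : ℝ) < n := by positivity
  have hj : ∀ j : ℕ, ‖z + j‖ ≠ 0 := fun j =>
    norm_ne_zero_iff.2 (ne_zero_of_zero_lt_re (by simp; positivity))
  have hpow : (n : ℝ) ^ z.re ≠ 0 := (Real.rpow_pos_of_pos hn0 _).ne'
  have hfac : (n.factorial : ℝ) ≠ 0 := by positivity
  rw [GammaSeq, norm_div, norm_mul, norm_prod, Complex.norm_natCast,
    Complex.norm_natCast_cpow_of_pos (Nat.pos_of_ne_zero hn),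
    Real.log_div (mul_ne_zero hpow hfac) (Finset.prod_ne_zero_iff.2 fun j _ => hj j),
    Real.log_mul hpow hfac, Real.log_rpow hn0, Real.log_prod fun j _ => hj j]

/-- `log |Γ|` is convex along horizontal half-lines in the sector `|Im z| < Re z`. -/
lemma convexOn_log_norm_Gamma (y : ℝ) :
    ConvexOn ℝ (Set.Ioi |y|) (fun u : ℝ => Real.log ‖Gamma (u + y * I)‖) := by
  have hpos : ∀ u ∈ Set.Ioi |y|, 0 < (u + y * I : ℂ).re := fun u hu => by
    simpa using (abs_nonneg y).trans_lt hu
  have hlim : ∀ u ∈ Set.Ioi |y|, Tendsto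
      (fun n => Real.log ‖GammaSeq (u + y * I : ℂ) n‖) atTop
      (𝓝 (Real.log ‖Gamma (u + y * I)‖)) := fun u hu =>
    ((GammaSeq_tendsto_Gamma _).norm).log
      (norm_ne_zero_iff.2 (Gamma_ne_zero_of_re_pos (hpos u hu)))
  have hconv : ∀ n : ℕ, n ≠ 0 →
      ConvexOn ℝ (Set.Ioi |y|) (fun u : ℝ => Real.log ‖GammaSeq (u + y * I : ℂ) n‖) := by
    intro n hn
    have hterm : ∀ j : ℕ, ∀ a b p q : ℝ, a ∈ Set.Ioi |y| → b ∈ Set.Ioi |y| → 0 ≤ p → 0 ≤ q →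
        p + q = 1 → p * Real.log ‖(a + y * I + j : ℂ)‖ + q * Real.log ‖(b + y * I + j : ℂ)‖ ≤
          Real.log ‖((p * a + q * b : ℝ) + y * I + j : ℂ)‖ := by
      intro j a b p q ha hb hp hq hpq
      have hmem : ∀ c ∈ Set.Ioi |y|, c + j ∈ Set.Ioi |y| := fun c hc => by
        have : |y| < c := hc
        simp only [Set.mem_Ioi]
        linarith [Nat.cast_nonneg (α := ℝ) j]
      have h := (concaveOn_log_norm_horizontal y).2 (hmem a ha) (hmem b hb) hp hq hpq
      simp only [smul_eq_mul] at h
      have e : p * (a + j) + q * (b + j) = p * a + q * b + j := by linear_combination (j : ℝ) * hpq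
      rw [e] at h
      push_cast at h ⊢
      have hr : ∀ c : ℂ, c + y * I + j = c + j + y * I := fun c => by ring
      rw [hr, hr, hr]
      exact h
    refine ⟨convex_Ioi _, fun a ha b hb p q hp hq hpq => ?_⟩
    have hc := (convex_Ioi |y|) ha hb hp hq hpq
    simp only [smul_eq_mul] at hc ⊢
    rw [log_norm_GammaSeq (hpos a ha) hn, log_norm_GammaSeq (hpos b hb) hn,
      log_norm_GammaSeq (hpos _ hc) hn]
    have hs := Finset.sum_le_sum fun j (_ : j ∈ Finset.range (n + 1)) =>
      hterm j a b p q ha hb hp hq hpq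
    rw [Finset.sum_add_distrib, ← Finset.mul_sum, ← Finset.mul_sum] at hs
    simp only [add_re, ofReal_re, mul_re, I_re, I_im, ofReal_im, mul_zero, mul_one, sub_zero,
      add_zero]
    linear_combination hs - Real.log n.factorial * hpq
  refine ⟨convex_Ioi _, fun a ha b hb p q hp hq hpq => ?_⟩
  refine le_of_tendsto_of_tendsto (hlim _ (convex_Ioi |y| ha hb hp hq hpq))
    (((hlim a ha).const_smul p).add ((hlim b hb).const_smul q)) ?_
  filter_upwards [eventually_ne_atTop 0] with n hn
  exact (hconv n hn).2 ha hb hp hq hpq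

lemma re_digamma_le_log_norm_of_abs_im_lt_re {z : ℂ} (hz : |z.im| < z.re) :
    (digamma z).re ≤ Real.log ‖z‖ := by
  have hre : 0 < z.re := (abs_nonneg _).trans_lt hz
  have hz0 : z ≠ 0 := ne_zero_of_zero_lt_re hre
  have hG : Gamma z ≠ 0 := Gamma_ne_zero_of_re_pos hre
  have hd : HasDerivAt (fun u : ℝ => Real.log ‖Gamma (u + z.im * I)‖) (digamma z).re z.re := by
    have := hasDerivAt_log_norm_horizontal (f := Gamma) (x := z.re) (y := z.im)
      (by rw [re_add_im]; exact differentiableAt_Gamma z (ne_neg_nat_of_re_pos hre))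
      (by rwa [re_add_im])
    rwa [re_add_im] at this
  have h := (convexOn_log_norm_Gamma z.im).le_slope_of_hasDerivAt (x := z.re) (y := z.re + 1)
    hz (by simp only [Set.mem_Ioi]; linarith) (by linarith) hd
  have e : ((z.re + 1 : ℝ) : ℂ) + z.im * I = z + 1 := by
    conv_rhs => rw [← re_add_im z]
    push_cast
    ring
  rw [slope_def_field, e, re_add_im, Gamma_add_one z hz0, norm_mul,
    Real.log_mul (norm_ne_zero_iff.2 hz0) (norm_ne_zero_iff.2 hG)] at h
  simpa using h

lemma log_norm_add_one_sub_log_norm_le {z : ℂ} (hz : 1 / 2 ≤ z.re) :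
    Real.log ‖z + 1‖ - Real.log ‖z‖ ≤
      (z⁻¹).re + (1 / (2 * z.re) - 1 / (2 * (z.re + 1))) := by
  set x := z.re with hx
  have hx0 : 0 < x := by linarith
  have hz0 : z ≠ 0 := ne_zero_of_zero_lt_re hx0
  have hR : ‖z‖ ^ 2 = x ^ 2 + z.im ^ 2 := by
    rw [← normSq_eq_norm_sq, normSq_apply]; ring
  have hR1 : ‖z + 1‖ ^ 2 = ‖z‖ ^ 2 + 2 * x + 1 := by
    rw [hR, ← normSq_eq_norm_sq, normSq_apply]; simp [← hx]; ring
  have hinv : (z⁻¹).re = x / ‖z‖ ^ 2 := by rw [inv_re, normSq_eq_norm_sq]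
  set R := ‖z‖ ^ 2 with hRdef
  have hxR : x ^ 2 ≤ R := by rw [hR]; nlinarith [sq_nonneg z.im]
  have hRpos : 0 < R := by nlinarith
  have hlog : Real.log ‖z + 1‖ - Real.log ‖z‖ = 1 / 2 * Real.log ((R + 2 * x + 1) / R) := by
    rw [← hR1, Real.log_div (by rw [hR1]; positivity) hRpos.ne', hRdef, Real.log_pow, Real.log_pow]
    push_cast
    ring
  have hw : 1 ≤ (R + 2 * x + 1) / R := by rw [le_div_iff₀ hRpos]; linarith
  have hsinh := Real.self_le_sinh_iff.2 (Real.log_nonneg hw)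
  rw [Real.sinh_log (by linarith)] at hsinh
  rw [hlog, hinv]
  have key : 1 / 4 * ((R + 2 * x + 1) / R - ((R + 2 * x + 1) / R)⁻¹) ≤
      x / R + (1 / (2 * x) - 1 / (2 * (x + 1))) := by
    rw [← sub_nonneg]
    have e : x / R + (1 / (2 * x) - 1 / (2 * (x + 1))) -
        1 / 4 * ((R + 2 * x + 1) / R - ((R + 2 * x + 1) / R)⁻¹) =
        (2 * R * (R + 2 * x + 1) - x * (x + 1) * (2 * R + 1 - 4 * x ^ 2)) /
          (4 * x * (x + 1) * R * (R + 2 * x + 1)) := by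
      have : R + 2 * x + 1 ≠ 0 := by positivity
      field_simp
      ring
    rw [e]
    refine div_nonneg ?_ (by positivity)
    obtain ⟨t, ht, hRt⟩ : ∃ t, 0 ≤ t ∧ R = x ^ 2 + t := ⟨R - x ^ 2, by linarith, by ring⟩
    obtain ⟨v, hv, hxv⟩ : ∃ v, 0 ≤ v ∧ x = 1 / 2 + v := ⟨x - 1 / 2, by linarith, by ring⟩
    rw [hRt, hxv]
    ring_nf
    positivity
  linarith

lemma re_digamma_le {z : ℂ} (hz : 1 / 2 ≤ z.re) :
    (digamma z).re ≤ Real.log ‖z‖ + 1 / (2 * z.re) := by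
  obtain ⟨n, hn⟩ := exists_nat_gt (|z.im| - z.re)
  induction n generalizing z with
  | zero =>
    have h := re_digamma_le_log_norm_of_abs_im_lt_re (z := z) (by simp at hn; linarith)
    have : 0 ≤ 1 / (2 * z.re) := by positivity
    linarith
  | succ n ih =>
    have h := @ih (z + 1) (by simp; linarith) (by simp at hn ⊢; linarith)
    rw [digamma_apply_add_one z (ne_neg_nat_of_re_pos (by linarith)), add_re] at h
    have h' := log_norm_add_one_sub_log_norm_le hz
    simp only [add_re, one_re] at h
    linarith

/-- The shifted archimedean factor `π ^ (-(w + c) / 2) Γ((w + c) / 2)` is differentiable and nonzero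
at `w = s` when `0 < Re (s + c)`, and its logarithmic derivative is given by `digamma`. -/
lemma differentiableAt_and_logDeriv_archimedean_factor {s c : ℂ} (h : 0 < (s + c).re) :
    DifferentiableAt ℂ (fun w => (Real.pi : ℂ) ^ (-(w + c) / 2) * Gamma ((w + c) / 2)) s ∧
    (Real.pi : ℂ) ^ (-(s + c) / 2) * Gamma ((s + c) / 2) ≠ 0 ∧
    logDeriv (fun w => (Real.pi : ℂ) ^ (-(w + c) / 2) * Gamma ((w + c) / 2)) s =
      (digamma ((s + c) / 2) - Real.log Real.pi) / 2 := by
  have hπ : (Real.pi : ℂ) ≠ 0 := by exact_mod_cast Real.pi_ne_zero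
  have hre : 0 < ((s + c) / 2).re := by
    rw [div_ofNat_re]
    positivity
  have hG := Gamma_ne_zero_of_re_pos hre
  have hP : (Real.pi : ℂ) ^ (-(s + c) / 2) ≠ 0 := by simp [cpow_eq_zero_iff, hπ]
  have h1 : HasDerivAt (fun w : ℂ => (Real.pi : ℂ) ^ (-(w + c) / 2))
      ((Real.pi : ℂ) ^ (-(s + c) / 2) * Complex.log Real.pi * (-1 / 2)) s :=
    ((((hasDerivAt_id s).add_const c).neg).div_const 2).const_cpow (Or.inl hπ)
  have h2 : HasDerivAt (fun w : ℂ => Gamma ((w + c) / 2))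
      (deriv Gamma ((s + c) / 2) * (1 / 2)) s :=
    (differentiableAt_Gamma _ (ne_neg_nat_of_re_pos hre)).hasDerivAt.comp s
      (((hasDerivAt_id s).add_const c).div_const 2)
  refine ⟨h1.differentiableAt.mul h2.differentiableAt, mul_ne_zero hP hG, ?_⟩
  rw [logDeriv_mul s hP hG h1.differentiableAt h2.differentiableAt, logDeriv_apply, logDeriv_apply,
    h1.deriv, h2.deriv, digamma_def, logDeriv_apply, ofReal_log Real.pi_pos.le]
  field_simp
  ring

lemma logDeriv_gammaFactor (a b : ℕ) {s : ℂ} (hs : 0 < s.re) :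
    logDeriv (gammaFactor a b) s = a * ((digamma (s / 2) - Real.log Real.pi) / 2) +
      b * ((digamma ((s + 1) / 2) - Real.log Real.pi) / 2) := by
  obtain ⟨d0, n0, l0⟩ := differentiableAt_and_logDeriv_archimedean_factor (s := s) (c := 0)
    (by simpa using hs)
  obtain ⟨d1, n1, l1⟩ := differentiableAt_and_logDeriv_archimedean_factor (s := s) (c := 1)
    (by simp; linarith)
  simp only [add_zero] at d0 n0 l0
  rw [← l0, ← l1, ← logDeriv_fun_pow d0, ← logDeriv_fun_pow d1]
  exact logDeriv_mul s (pow_ne_zero _ n0) (pow_ne_zero _ n1) (d0.pow a) (d1.pow b)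

lemma re_digamma_half_le {s w : ℂ} (hσ : 1 < s.re) (hre : s.re ≤ w.re) (hw : ‖w‖ ≤ ‖s‖ + 1) :
    (digamma (w / 2)).re ≤ Real.log (‖s‖ + 1) + (s.re)⁻¹ := by
  have hre2 : (w / 2).re = w.re / 2 := div_ofNat_re w 2
  have h := re_digamma_le (z := w / 2) (by rw [hre2]; linarith)
  have hpos : 0 < ‖w / 2‖ :=
    norm_pos_iff.2 (ne_zero_of_zero_lt_re (by rw [hre2]; linarith))
  have hlog : Real.log ‖w / 2‖ ≤ Real.log (‖s‖ + 1) := by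
    refine Real.log_le_log hpos ?_
    rw [norm_div, Complex.norm_ofNat]
    linarith [norm_nonneg w]
  have hinv : 1 / (2 * (w / 2).re) ≤ (s.re)⁻¹ := by
    rw [hre2, one_div]
    exact inv_anti₀ (by linarith) (by linarith)
  linarith

/-- **Digamma bounds** (Lemma 2.4). For `s = σ + it` with `σ > 1`:
`Re{Γ'/Γ(s)} ≤ log|s| + σ⁻¹`, and for any Hecke character `χ` (with gamma-factor exponents
`a(χ) + b(χ) = n_K`), `Re{γ_χ'/γ_χ(s)} ≤ (n_K/2)(log(|s|+1) + σ⁻¹ - log π)`. -/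
theorem digamma_bounds (K : Type) [Field K] [NumberField K]
    (𝔮 : Ideal (𝓞 K)) (χ : HeckeChar K 𝔮) (a b : ℕ) (hab : a + b = nK K)
    (s : ℂ) (hσ : 1 < s.re) :
    (logDeriv Complex.Gamma s).re ≤ Real.log ‖s‖ + (s.re)⁻¹ ∧
    (logDeriv (gammaFactor a b) s).re ≤
      (nK K : ℝ) / 2 * (Real.log (‖s‖ + 1) + (s.re)⁻¹ - Real.log Real.pi) := by
  have hs0 : (0 : ℝ) < s.re := by linarith
  constructor
  · have h := re_digamma_le (z := s) (by linarith)
    have hinv : 1 / (2 * s.re) ≤ (s.re)⁻¹ := by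
      rw [one_div]
      exact inv_anti₀ hs0 (by linarith)
    rw [digamma_def] at h
    linarith
  · have h0 := re_digamma_half_le (w := s) hσ le_rfl (by linarith)
    have h1 := re_digamma_half_le (w := s + 1) hσ (by simp)
      ((norm_add_le s 1).trans_eq (by rw [norm_one]))
    have hcast : (nK K : ℝ) = a + b := by exact_mod_cast hab.symm
    rw [logDeriv_gammaFactor a b hs0, hcast]
    simp only [add_re, mul_re, natCast_re, natCast_im, zero_mul, sub_zero, div_ofNat_re, sub_re,
      ofReal_re]
    linear_combination (a : ℝ) / 2 * h0 + (b : ℝ) / 2 * h1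

end RTZ
end
end

section
/- Let η > 0 and let C₁ = C₁(η) ≥ 3 be sufficiently large. If x ≥ C₁ · e^{O_η(n_K)} · ( n_K^{n_K} D_K )^{1/2 + η}, then Σ_{N𝔫 ≤ x} 1/N𝔫 ≫_η κ_K · log x, where the sum runs over the nonzero integral ideals 𝔫 of K. -/
open scoped BigOperators
open Complex NumberField Filter Topology

noncomputable section

namespace RTZ

variable {K : Type*} [Field K] [NumberField K]

section ScaledLattice

open MeasureTheory mixedEmbedding InfinitePlace
open scoped ENNReal Classical nonZeroDivisors

theorem sq_lintegral_le_measure_mul_tsum {G E : Type*} [AddGroup G] [Countable G]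
    [AddAction G E] [MeasurableSpace E] [MeasurableConstVAdd G E] {μ : Measure E}
    [VAddInvariantMeasure G E μ] {D : Set E} (hD : IsAddFundamentalDomain G D μ)
    {g : E → ℝ≥0∞} (hg : Measurable g) :
    (∫⁻ y, g y ∂μ) ^ 2 ≤ μ D * ∑' l : G, ∫⁻ y, g y * g (l +ᵥ y) ∂μ := by
  have hgl : ∀ l : G, Measurable fun y => g (l +ᵥ y) := fun l =>
    hg.comp (measurable_const_vadd l)
  set S : E → ℝ≥0∞ := fun y => ∑' m : G, g (m +ᵥ y) with hS
  have hSm : Measurable S := Measurable.tsum hgl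
  have h₁ : ∫⁻ y, g y ∂μ = ∫⁻ y in D, S y ∂μ := by
    rw [hD.lintegral_eq_tsum'', ← lintegral_tsum fun l => (hgl l).aemeasurable]
  have h₂ : ∑' l : G, ∫⁻ y, g y * g (l +ᵥ y) ∂μ = ∫⁻ y in D, S y ^ 2 ∂μ := by
    have h : ∀ l : G, ∫⁻ y, g y * g (l +ᵥ y) ∂μ =
        ∫⁻ y in D, ∑' m : G, g (m +ᵥ y) * g (l +ᵥ m +ᵥ y) ∂μ := fun l => by
      rw [hD.lintegral_eq_tsum'', ← lintegral_tsum fun m => ?_]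
      exact ((hgl m).mul ((hgl l).comp (measurable_const_vadd m))).aemeasurable
    simp_rw [h]
    rw [← lintegral_tsum fun l => ?_]
    · refine lintegral_congr fun y => ?_
      rw [ENNReal.tsum_comm, sq]
      simp_rw [ENNReal.tsum_mul_left]
      rw [hS, ← ENNReal.tsum_mul_right]
      refine tsum_congr fun m => ?_
      congr 1
      simp_rw [← add_vadd]
      exact (Equiv.addRight m).tsum_eq fun k => g (k +ᵥ y)
    · exact (Measurable.tsum fun m =>
        (hgl m).mul ((hgl l).comp (measurable_const_vadd m))).aemeasurable
  rw [h₁, h₂]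
  have h := ENNReal.lintegral_mul_le_Lp_mul_Lq (μ.restrict D) Real.HolderConjugate.two_two
    (f := 1) (g := S) aemeasurable_const hSm.aemeasurable
  simp only [one_mul, Pi.one_apply, ENNReal.one_rpow, lintegral_const, Measure.restrict_apply,
    MeasurableSet.univ, Set.univ_inter] at h
  calc (∫⁻ y in D, S y ∂μ) ^ 2
      ≤ (μ D ^ (1 / 2 : ℝ) * (∫⁻ y in D, S y ^ (2 : ℝ) ∂μ) ^ (1 / 2 : ℝ)) ^ 2 := by gcongr
    _ = μ D * ∫⁻ y in D, S y ^ 2 ∂μ := by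
      rw [mul_pow, ← ENNReal.rpow_natCast, ← ENNReal.rpow_natCast, ← ENNReal.rpow_mul,
        ← ENNReal.rpow_mul]
      norm_num

theorem abs_det_mulLeft_mixedSpace (x : mixedSpace K) :
    |LinearMap.det (LinearMap.mulLeft ℝ x)| = mixedEmbedding.norm x := by
  have h : LinearMap.mulLeft ℝ x = LinearMap.prodMap
      (LinearMap.pi fun w => LinearMap.mulLeft ℝ (x.1 w) ∘ₗ LinearMap.proj w)
      (LinearMap.pi fun w => LinearMap.mulLeft ℝ (x.2 w) ∘ₗ LinearMap.proj w) := by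
    ext <;> simp
  rw [h, LinearMap.det_prodMap, LinearMap.det_pi, LinearMap.det_pi, mixedEmbedding.norm_apply,
    prod_eq_prod_mul_prod, abs_mul, Finset.abs_prod, Finset.abs_prod]
  congr 1
  · refine Finset.prod_congr rfl fun w _ => ?_
    rw [mult_isReal, normAtPlace_apply_of_isReal w.2, pow_one, LinearMap.det_mulLeft, Real.norm_eq_abs]
  · refine Finset.prod_congr rfl fun w _ => ?_
    rw [mult_isComplex, normAtPlace_apply_of_isComplex w.2,
      show LinearMap.mulLeft ℝ (x.2 w) = Algebra.lmul ℝ ℂ (x.2 w) from rfl, ← Algebra.norm_apply,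
      Algebra.norm_complex_apply, abs_of_nonneg (Complex.normSq_nonneg _),
      Complex.normSq_eq_norm_sq]

theorem lintegral_comp_mul_mixedSpace {x : mixedSpace K} (hx : mixedEmbedding.norm x ≠ 0)
    {g : mixedSpace K → ℝ≥0∞} (hg : Measurable g) :
    ∫⁻ y, g (x * y) = ENNReal.ofReal (mixedEmbedding.norm x)⁻¹ * ∫⁻ y, g y := by
  have hdet : LinearMap.det (LinearMap.mulLeft ℝ x) ≠ 0 := by
    rwa [← abs_ne_zero, abs_det_mulLeft_mixedSpace]
  have h := Measure.map_linearMap_addHaar_eq_smul_addHaar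
    (volume : Measure (mixedSpace K)) hdet
  rw [abs_inv, abs_det_mulLeft_mixedSpace] at h
  rw [← smul_eq_mul, ← lintegral_smul_measure, ← h, lintegral_map hg]
  · rfl
  · exact (LinearMap.continuous_of_finiteDimensional _).measurable

/-- The points of the mixed space all of whose coordinates have absolute value below `1 / 2`. -/
def halfBox (K : Type*) [Field K] [NumberField K] : Set (mixedSpace K) :=
  convexBodyLT K fun _ => 1 / 2

/-- The autocorrelation of the indicator function of `halfBox`. -/
def halfBoxCorr (z : mixedSpace K) : ℝ≥0∞ :=
  ∫⁻ y, (halfBox K).indicator 1 y * (halfBox K).indicator 1 (z + y)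

theorem measurableSet_halfBox : MeasurableSet (halfBox K) :=
  ((MeasurableSet.univ_pi fun _ => measurableSet_ball).prod
    (MeasurableSet.univ_pi fun _ => measurableSet_ball))

theorem measurable_indicator_halfBox :
    Measurable ((halfBox K).indicator (1 : mixedSpace K → ℝ≥0∞)) :=
  measurable_one.indicator measurableSet_halfBox

theorem volume_halfBox :
    volume (halfBox K) = ENNReal.ofReal ((Real.pi / 4) ^ nrComplexPlaces K) := by
  rw [halfBox, convexBodyLT_volume]
  have h : ∏ w : InfinitePlace K, ((1 / 2 : NNReal)) ^ mult w =
      (1 / 2) ^ nrRealPlaces K * (1 / 4) ^ nrComplexPlaces K := by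
    rw [prod_eq_prod_mul_prod]
    simp only [mult_isReal, mult_isComplex, Finset.prod_const, Finset.card_univ]
    norm_num
  rw [← ENNReal.ofReal_coe_nnreal, ← ENNReal.ofReal_coe_nnreal,
    ← ENNReal.ofReal_mul NNReal.zero_le_coe, ← NNReal.coe_mul, h]
  push_cast
  rw [NNReal.coe_real_pi]
  congr 1
  rw [mul_mul_mul_comm, ← mul_pow, ← mul_pow]
  norm_num [div_eq_mul_inv]

theorem measurable_halfBoxCorr : Measurable (halfBoxCorr (K := K)) := by
  refine Measurable.lintegral_prod_right ?_
  exact (measurable_indicator_halfBox.comp measurable_snd).mul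
    (measurable_indicator_halfBox.comp (measurable_fst.add measurable_snd))

theorem lintegral_halfBoxCorr :
    ∫⁻ z, halfBoxCorr (K := K) z = volume (halfBox K) ^ 2 := by
  simp only [halfBoxCorr]
  rw [lintegral_lintegral_swap]
  · have h (y : mixedSpace K) : ∫⁻ z, (halfBox K).indicator 1 y * (halfBox K).indicator 1 (z + y) =
        (halfBox K).indicator 1 y * volume (halfBox K) := by
      rw [lintegral_const_mul _ (f := fun z => (halfBox K).indicator 1 (z + y))
          (measurable_indicator_halfBox.comp (measurable_add_const y)),
        lintegral_add_right_eq_self (fun z => (halfBox K).indicator (1 : mixedSpace K → ℝ≥0∞) z) y,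
        lintegral_indicator_one measurableSet_halfBox]
    simp_rw [h]
    rw [lintegral_mul_const _ measurable_indicator_halfBox,
      lintegral_indicator_one measurableSet_halfBox, sq]
  · exact ((measurable_indicator_halfBox.comp measurable_snd).mul
      (measurable_indicator_halfBox.comp (measurable_fst.add measurable_snd))).aemeasurable

theorem halfBoxCorr_le (z : mixedSpace K) : halfBoxCorr z ≤ volume (halfBox K) := by
  rw [halfBoxCorr, ← lintegral_indicator_one measurableSet_halfBox]
  refine lintegral_mono fun y => mul_le_of_le_one_right' ?_
  exact Set.indicator_le_self' (fun _ _ => zero_le) _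

theorem normAtPlace_lt_of_mem_halfBox {y : mixedSpace K} (hy : y ∈ halfBox K)
    (w : InfinitePlace K) : normAtPlace w y < 1 / 2 := by
  obtain ⟨h₁, h₂⟩ := hy
  rcases isReal_or_isComplex w with hw | hw
  · rw [normAtPlace_apply_of_isReal hw]
    simpa using h₁ ⟨w, hw⟩ trivial
  · rw [normAtPlace_apply_of_isComplex hw]
    simpa using h₂ ⟨w, hw⟩ trivial

theorem norm_le_one_of_halfBoxCorr_ne_zero {z : mixedSpace K} (hz : halfBoxCorr z ≠ 0) :
    mixedEmbedding.norm z ≤ 1 := by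
  obtain ⟨y, hy, hzy⟩ : ∃ y, y ∈ halfBox K ∧ z + y ∈ halfBox K := by
    contrapose! hz
    rw [halfBoxCorr, lintegral_eq_zero_iff]
    · refine Eventually.of_forall fun y => ?_
      by_cases hy : y ∈ halfBox K <;> simp [hy, hz]
    · exact measurable_indicator_halfBox.mul
        (measurable_indicator_halfBox.comp (measurable_const_add z))
  rw [mixedEmbedding.norm_apply]
  refine Finset.prod_le_one (fun w _ => pow_nonneg (normAtPlace_nonneg w z) _) fun w _ =>
    pow_le_one₀ (normAtPlace_nonneg w z) ?_
  have h := normAtPlace_add_le w (z + y) (-y)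
  rw [normAtPlace_neg, add_neg_cancel_right] at h
  linarith [normAtPlace_lt_of_mem_halfBox hy w, normAtPlace_lt_of_mem_halfBox hzy w]

theorem sq_volume_halfBox_le_tsum {x : mixedSpace K} (hx : mixedEmbedding.norm x ≠ 0)
    (I : (FractionalIdeal (nonZeroDivisors (𝓞 K)) K)ˣ) :
    ENNReal.ofReal (mixedEmbedding.norm x)⁻¹ * volume (halfBox K) ^ 2 ≤
      ENNReal.ofReal (ZLattice.covolume (mixedEmbedding.idealLattice K I)) *
        ∑' l : mixedEmbedding.idealLattice K I, halfBoxCorr (x * (l : mixedSpace K)) := by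
  have hg := measurable_indicator_halfBox (K := K)
  have hm : Measurable fun y : mixedSpace K => x * y := (continuous_const_mul x).measurable
  have : VAddInvariantMeasure (mixedEmbedding.idealLattice K I) (mixedSpace K) volume :=
    ⟨fun c s _ => measure_preimage_add _ (c : mixedSpace K) s⟩
  have h := sq_lintegral_le_measure_mul_tsum (fundamentalDomain_idealLattice K I) (hg.comp hm)
  simp only [Function.comp_apply] at h
  have hl (l : mixedEmbedding.idealLattice K I) :
      ∫⁻ y, (halfBox K).indicator (1 : mixedSpace K → ℝ≥0∞) (x * y) *
        (halfBox K).indicator 1 (x * (l +ᵥ y)) =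
      ENNReal.ofReal (mixedEmbedding.norm x)⁻¹ * halfBoxCorr (x * (l : mixedSpace K)) := by
    rw [halfBoxCorr, ← lintegral_comp_mul_mixedSpace hx]
    · refine lintegral_congr fun y => ?_
      rw [Submodule.vadd_def, vadd_eq_add, mul_add]
    · exact hg.mul (hg.comp (measurable_const_add _))
  simp_rw [hl] at h
  rw [lintegral_comp_mul_mixedSpace hx hg, lintegral_indicator_one measurableSet_halfBox,
    ENNReal.tsum_mul_left] at h
  have hx' : 0 < mixedEmbedding.norm x := lt_of_le_of_ne (mixedEmbedding.norm_nonneg x) hx.symm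
  have h0 : ENNReal.ofReal (mixedEmbedding.norm x)⁻¹ ≠ 0 := by simpa using hx'
  rw [ZLattice.covolume_eq_measure_fundamentalDomain _ _ (fundamentalDomain_idealLattice K I),
    measureReal_def, ENNReal.ofReal_toReal]
  · rw [mul_pow, sq, mul_assoc, mul_left_comm (volume _)] at h
    exact (ENNReal.mul_le_mul_iff_right h0 ENNReal.ofReal_ne_top).1 h
  · exact (ZSpan.fundamentalDomain_isBounded _).measure_lt_top.ne

open fundamentalCone Pointwise in
theorem volume_fundamentalCone_inter_norm_le {s : ℝ} (hs : 0 < s) :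
    volume (fundamentalCone K ∩ mixedEmbedding.norm ⁻¹' Set.Iic s) =
      volume (normLeOne K) * ENNReal.ofReal s := by
  have hn : Module.finrank ℚ K ≠ 0 := Module.finrank_pos.ne'
  set c : ℝ := s ^ ((Module.finrank ℚ K : ℝ)⁻¹) with hc
  have hc0 : 0 < c := Real.rpow_pos_of_pos hs _
  have hcs : c ^ Module.finrank ℚ K = s := Real.rpow_inv_natCast_pow hs.le hn
  have h : fundamentalCone K ∩ mixedEmbedding.norm ⁻¹' Set.Iic s = c • normLeOne K := by
    ext x
    rw [Set.mem_smul_set_iff_inv_smul_mem₀ hc0.ne', mem_normLeOne,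
      smul_mem_iff_mem (inv_ne_zero hc0.ne'), mixedEmbedding.norm_smul,
      abs_of_pos (inv_pos.2 hc0), inv_pow, hcs, inv_mul_le_iff₀ hs, mul_one]
    rfl
  rw [h, Measure.addHaar_smul, mixedEmbedding.finrank, abs_of_nonneg (pow_nonneg hc0.le _), hcs,
    mul_comm]

theorem volume_normLeOne_ne_top : volume (fundamentalCone.normLeOne K) ≠ ∞ :=
  (fundamentalCone.isBounded_normLeOne K).measure_lt_top.ne

/-- The norm pushes the Lebesgue measure on the fundamental cone forward to a multiple of the
Lebesgue measure on the positive half-line. -/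
theorem map_norm_volume_restrict_fundamentalCone :
    (volume.restrict (fundamentalCone K)).map mixedEmbedding.norm =
      volume (fundamentalCone.normLeOne K) • volume.restrict (Set.Ioi (0 : ℝ)) := by
  have hN : Measurable (mixedEmbedding.norm : mixedSpace K → ℝ) :=
    (mixedEmbedding.continuous_norm K).measurable
  have hIic (s : ℝ) : (volume.restrict (fundamentalCone K)).map mixedEmbedding.norm (Set.Iic s) =
      volume (fundamentalCone.normLeOne K) * ENNReal.ofReal s := by
    rw [Measure.map_apply hN measurableSet_Iic, Measure.restrict_apply (hN measurableSet_Iic),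
      Set.inter_comm]
    rcases lt_or_ge 0 s with hs | hs
    · exact volume_fundamentalCone_inter_norm_le hs
    · rw [ENNReal.ofReal_of_nonpos hs, mul_zero]
      convert measure_empty (μ := (volume : Measure (mixedSpace K)))
      refine Set.eq_empty_of_forall_notMem fun x hx => ?_
      exact absurd (fundamentalCone.norm_pos_of_mem hx.1) (not_lt.2 (hx.2.trans hs))
  have hIoc {a b : ℝ} (hab : a < b) :
      (volume.restrict (fundamentalCone K)).map mixedEmbedding.norm (Set.Ioc a b) =
        volume (fundamentalCone.normLeOne K) * (ENNReal.ofReal b - ENNReal.ofReal a) := by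
    rw [← Set.Iic_sdiff_Iic, measure_sdiff (Set.Iic_subset_Iic.2 hab.le)
      measurableSet_Iic.nullMeasurableSet, hIic, hIic, ENNReal.mul_sub]
    · exact fun _ _ => volume_normLeOne_ne_top
    · rw [hIic]
      exact ENNReal.mul_ne_top volume_normLeOne_ne_top ENNReal.ofReal_ne_top
  refine Measure.ext_of_Ioc' _ _ (fun a b hab => ?_) fun a b hab => ?_
  · rw [hIoc hab]
    exact ENNReal.mul_ne_top volume_normLeOne_ne_top (by finiteness)
  · rw [hIoc hab, Measure.smul_apply, Measure.restrict_apply measurableSet_Ioc, Set.Ioc_inter_Ioi,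
      Real.volume_Ioc, ENNReal.ofReal_sub _ le_sup_right, smul_eq_mul]
    rcases le_total a 0 with ha | ha
    · rw [max_eq_right ha, ENNReal.ofReal_zero, ENNReal.ofReal_of_nonpos ha]
    · rw [max_eq_left ha]

theorem volume_fundamentalCone_inter_norm_Ioc_le (a b : ℝ) :
    volume (fundamentalCone K ∩ mixedEmbedding.norm ⁻¹' Set.Ioc a b) ≤
      volume (fundamentalCone.normLeOne K) * ENNReal.ofReal b := by
  have hN : Measurable (mixedEmbedding.norm : mixedSpace K → ℝ) :=
    (mixedEmbedding.continuous_norm K).measurable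
  rw [Set.inter_comm, ← Measure.restrict_apply (hN measurableSet_Ioc),
    ← Measure.map_apply hN measurableSet_Ioc, map_norm_volume_restrict_fundamentalCone,
    Measure.smul_apply, smul_eq_mul, Measure.restrict_apply measurableSet_Ioc]
  gcongr
  calc volume (Set.Ioc a b ∩ Set.Ioi 0) ≤ volume (Set.Ioc 0 b) :=
        measure_mono fun t ht => ⟨ht.2, ht.1.2⟩
    _ = ENNReal.ofReal b := by rw [Real.volume_Ioc, sub_zero]

theorem setLIntegral_inv_norm_fundamentalCone {a b : ℝ} (ha : 0 < a) (hab : a ≤ b) :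
    ∫⁻ x in fundamentalCone K ∩ mixedEmbedding.norm ⁻¹' Set.Ioc a b,
        ENNReal.ofReal (mixedEmbedding.norm x)⁻¹ =
      volume (fundamentalCone.normLeOne K) * ENNReal.ofReal (Real.log (b / a)) := by
  have hN : Measurable (mixedEmbedding.norm : mixedSpace K → ℝ) :=
    (mixedEmbedding.continuous_norm K).measurable
  have hf : Measurable fun t : ℝ => ENNReal.ofReal t⁻¹ :=
    ENNReal.measurable_ofReal.comp measurable_inv
  rw [Set.inter_comm, ← Measure.restrict_restrict (hN measurableSet_Ioc),
    ← setLIntegral_map measurableSet_Ioc hf hN, map_norm_volume_restrict_fundamentalCone,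
    Measure.restrict_smul, lintegral_smul_measure, smul_eq_mul,
    Measure.restrict_restrict measurableSet_Ioc,
    Set.inter_eq_left.2 (show Set.Ioc a b ⊆ Set.Ioi 0 from fun t ht => ha.trans ht.1),
    ← ofReal_integral_eq_lintegral_ofReal,
    ← intervalIntegral.integral_of_le hab, integral_inv_of_pos ha (ha.trans_le hab)]
  · change IntegrableOn (fun t : ℝ => t⁻¹) _ _
    rw [← intervalIntegrable_iff_integrableOn_Ioc_of_le hab]
    refine intervalIntegral.intervalIntegrable_inv (fun t ht => ?_) continuousOn_id
    rw [Set.uIcc_of_le hab] at ht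
    exact (ha.trans_le ht.1).ne'
  · refine (ae_restrict_iff' measurableSet_Ioc).2 (Eventually.of_forall fun t ht => ?_)
    exact inv_nonneg.2 (ha.trans ht.1).le

theorem tsum_indicator_unit_smul_le (y : mixedSpace K) :
    ∑' u : (𝓞 K)ˣ, (fundamentalCone K).indicator (1 : mixedSpace K → ℝ≥0∞) (u⁻¹ • y) ≤
      Units.torsionOrder K := by
  by_cases h : ∃ u : (𝓞 K)ˣ, u⁻¹ • y ∈ fundamentalCone K
  · obtain ⟨u₀, hu₀⟩ := h
    rw [← (Equiv.mulLeft u₀).tsum_eq]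
    rw [← (Equiv.inv (𝓞 K)ˣ).tsum_eq]
    have h (v : (𝓞 K)ˣ) : (fundamentalCone K).indicator (1 : mixedSpace K → ℝ≥0∞)
        ((Equiv.mulLeft u₀ (Equiv.inv (𝓞 K)ˣ v))⁻¹ • y) =
        (Units.torsion K : Set (𝓞 K)ˣ).indicator 1 v := by
      have h₁ : (Equiv.mulLeft u₀ (Equiv.inv (𝓞 K)ˣ v))⁻¹ • y =
          v • u₀⁻¹ • y := by
        simp [mul_smul, -unitSMul_smul]
      rw [h₁, Set.indicator_apply, Set.indicator_apply,
        fundamentalCone.unit_smul_mem_iff_mem_torsion hu₀]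
      rfl
    simp_rw [h]
    rw [← tsum_subtype (Units.torsion K : Set (𝓞 K)ˣ) 1]
    simp [Units.torsionOrder, ENat.card_eq_coe_natCard]
  · push Not at h
    simp [h, -unitSMul_smul]

theorem tsum_setLIntegral_unit_smul_le {G : mixedSpace K → ℝ≥0∞} (hG : Measurable G) :
    ∑' u : (𝓞 K)ˣ, ∫⁻ x in fundamentalCone K, G (u • x) ≤
      Units.torsionOrder K * ∫⁻ x, G x := by
  have hFC : Measurable ((fundamentalCone K).indicator (1 : mixedSpace K → ℝ≥0∞)) :=
    measurable_one.indicator (measurableSet_fundamentalCone K)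
  have hs (u : (𝓞 K)ˣ) : Measurable fun x : mixedSpace K => u • x := by
    simp_rw [unitSMul_smul]
    exact (continuous_const_mul _).measurable
  have h (u : (𝓞 K)ˣ) : ∫⁻ x in fundamentalCone K, G (u • x) =
      ∫⁻ y, (fundamentalCone K).indicator 1 (u⁻¹ • y) * G y := by
    have hu : mixedEmbedding.norm (mixedEmbedding K (u : 𝓞 K)) = 1 := norm_unit u
    have h := lintegral_comp_mul_mixedSpace (x := mixedEmbedding K (u : 𝓞 K))
      (by rw [hu]; exact one_ne_zero) ((hFC.comp (hs u⁻¹)).mul hG)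
    rw [hu, inv_one, ENNReal.ofReal_one, one_mul] at h
    simp only [Pi.mul_apply, Function.comp_apply] at h
    simp only [← unitSMul_smul, inv_smul_smul] at h
    rw [← h, ← lintegral_indicator (measurableSet_fundamentalCone K)]
    refine lintegral_congr fun x => ?_
    by_cases hx : x ∈ fundamentalCone K <;> simp [hx, -unitSMul_smul]
  have : Countable (𝓞 K) := (RingOfIntegers.basis K).equivFun.toEquiv.countable_iff.2 inferInstance
  have : Countable (𝓞 K)ˣ := Units.val_injective.countable
  simp_rw [h]
  have hm (u : (𝓞 K)ˣ) :
      Measurable fun y => (fundamentalCone K).indicator (1 : mixedSpace K → ℝ≥0∞) (u⁻¹ • y) * G y :=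
    (hFC.comp (hs u⁻¹)).mul hG
  rw [← lintegral_tsum fun u => (hm u).aemeasurable, ← lintegral_const_mul _ hG]
  refine lintegral_mono fun y => ?_
  rw [ENNReal.tsum_mul_right]
  gcongr
  exact tsum_indicator_unit_smul_le y

theorem norm_mixedEmbedding_algebraicInt (α : 𝓞 K) :
    mixedEmbedding.norm (mixedEmbedding K (α : K)) = Ideal.absNorm (Ideal.span {α}) := by
  rw [mixedEmbedding.norm_eq_norm, Ideal.absNorm_span_singleton, ← Algebra.coe_norm_int]
  simp [Nat.cast_natAbs]

/-- Unfolding over the units the autocorrelation of `halfBox`, evaluated along the associates of a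
nonzero algebraic integer. -/
theorem tsum_setLIntegral_halfBoxCorr_le {β : 𝓞 K} (hβ : β ≠ 0) :
    ∑' u : (𝓞 K)ˣ, ∫⁻ x in fundamentalCone K,
        halfBoxCorr (x * mixedEmbedding K ((u : 𝓞 K) * β : 𝓞 K)) ≤
      Units.torsionOrder K * (ENNReal.ofReal (Ideal.absNorm (Ideal.span {β}) : ℝ)⁻¹ *
        volume (halfBox K) ^ 2) := by
  have hN := norm_mixedEmbedding_algebraicInt β
  have h0 : mixedEmbedding.norm (mixedEmbedding K (β : K)) ≠ 0 := by
    rw [hN]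
    simpa [Ideal.absNorm_eq_zero_iff] using hβ
  have h := lintegral_comp_mul_mixedSpace h0 (measurable_halfBoxCorr (K := K))
  rw [lintegral_halfBoxCorr, hN] at h
  rw [← h]
  refine le_trans (le_of_eq ?_) (tsum_setLIntegral_unit_smul_le
    (measurable_halfBoxCorr.comp (continuous_const_mul _).measurable))
  refine tsum_congr fun u => lintegral_congr fun x => ?_
  rw [unitSMul_smul]
  rw [show ((u * β : 𝓞 K) : K) = (u : K) * (β : K) from map_mul _ _ _, map_mul,
    mul_left_comm, mul_comm (mixedEmbedding K (β : K))]
  ring_nf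

/-- The part of the fundamental cone where the norm lies in `(a, b]`. -/
def coneShell (K : Type*) [Field K] [NumberField K] (a b : ℝ) : Set (mixedSpace K) :=
  fundamentalCone K ∩ mixedEmbedding.norm ⁻¹' Set.Ioc a b

theorem measurableSet_coneShell (a b : ℝ) : MeasurableSet (coneShell K a b) :=
  (measurableSet_fundamentalCone K).inter
    ((mixedEmbedding.continuous_norm K).measurable measurableSet_Ioc)

theorem volume_normLeOne_mul_log_le {a b : ℝ} (ha : 0 < a) (hab : a ≤ b)
    (I : (FractionalIdeal (nonZeroDivisors (𝓞 K)) K)ˣ) :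
    volume (fundamentalCone.normLeOne K) * ENNReal.ofReal (Real.log (b / a)) *
        volume (halfBox K) ^ 2 ≤
      ENNReal.ofReal (ZLattice.covolume (mixedEmbedding.idealLattice K I)) *
        (volume (halfBox K) * (volume (fundamentalCone.normLeOne K) * ENNReal.ofReal b) +
          ∑' l : mixedEmbedding.idealLattice K I, if (l : mixedSpace K) = 0 then 0 else
            ∫⁻ x in coneShell K a b, halfBoxCorr (x * (l : mixedSpace K))) := by
  have hm (l : mixedEmbedding.idealLattice K I) :
      Measurable fun x : mixedSpace K => halfBoxCorr (x * (l : mixedSpace K)) :=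
    measurable_halfBoxCorr.comp (continuous_mul_const _).measurable
  have h : ∫⁻ x in coneShell K a b, ENNReal.ofReal (mixedEmbedding.norm x)⁻¹ *
        volume (halfBox K) ^ 2 ≤
      ∫⁻ x in coneShell K a b,
        ENNReal.ofReal (ZLattice.covolume (mixedEmbedding.idealLattice K I)) *
          ∑' l : mixedEmbedding.idealLattice K I, halfBoxCorr (x * (l : mixedSpace K)) :=
    setLIntegral_mono' (measurableSet_coneShell a b) fun x hx =>
      sq_volume_halfBox_le_tsum (fundamentalCone.norm_pos_of_mem hx.1).ne' I
  rw [lintegral_mul_const, coneShell, setLIntegral_inv_norm_fundamentalCone ha hab,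
    lintegral_const_mul _ (Measurable.tsum hm),
    lintegral_tsum fun l => (hm l).aemeasurable,
    ENNReal.tsum_eq_add_tsum_ite (0 : mixedEmbedding.idealLattice K I)] at h
  · refine h.trans ?_
    gcongr
    · calc _ ≤ ∫⁻ x in coneShell K a b, volume (halfBox K) := lintegral_mono fun x => halfBoxCorr_le _
        _ ≤ _ := by
          rw [setLIntegral_const]
          gcongr
          exact volume_fundamentalCone_inter_norm_Ioc_le a b
    · simp only [ZeroMemClass.coe_eq_zero]
      split_ifs <;> rfl
  · exact ENNReal.measurable_ofReal.comp
      ((mixedEmbedding.continuous_norm K).measurable.inv)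

theorem mem_idealLattice_mk0 {J : (Ideal (𝓞 K))⁰} {y : mixedSpace K} :
    y ∈ mixedEmbedding.idealLattice K (FractionalIdeal.mk0 K J) ↔
      ∃ α ∈ (J : Ideal (𝓞 K)), mixedEmbedding K (α : K) = y := by
  rw [mem_idealLattice, FractionalIdeal.coe_mk0]
  constructor
  · rintro ⟨_, ⟨α, hα, rfl⟩, rfl⟩
    exact ⟨α, hα, rfl⟩
  · rintro ⟨α, hα, rfl⟩
    exact ⟨_, ⟨α, hα, rfl⟩, rfl⟩

theorem exists_mul_eq_span_singleton {J : Ideal (𝓞 K)} (hJ0 : J ≠ ⊥) {α : 𝓞 K} (hα : α ∈ J)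
    (hα0 : α ≠ 0) {x : ℝ} (hx : (Ideal.absNorm (Ideal.span {α}) : ℝ) ≤ x * Ideal.absNorm J) :
    ∃ 𝔫 : Ideal (𝓞 K), (𝔫 ≠ ⊥ ∧ (Ideal.absNorm 𝔫 : ℝ) ≤ x) ∧ 𝔫 * J = Ideal.span {α} := by
  obtain ⟨𝔫, h𝔫⟩ := Ideal.dvd_span_singleton.2 hα
  rw [mul_comm] at h𝔫
  refine ⟨𝔫, ⟨?_, ?_⟩, h𝔫.symm⟩
  · rintro rfl
    rw [Ideal.bot_mul, Ideal.span_singleton_eq_bot] at h𝔫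
    exact hα0 h𝔫
  · rw [h𝔫, map_mul, Nat.cast_mul] at hx
    exact le_of_mul_le_mul_right hx
      (Nat.cast_pos.2 (Nat.pos_of_ne_zero (mt Ideal.absNorm_eq_zero_iff.1 hJ0)))

theorem norm_mul_le_of_setLIntegral_ne_zero {a b : ℝ} (ha : 0 < a) {α : 𝓞 K}
    (h : ∫⁻ y in coneShell K a b, halfBoxCorr (y * mixedEmbedding K (α : K)) ≠ 0) :
    (Ideal.absNorm (Ideal.span {α}) : ℝ) ≤ a⁻¹ := by
  obtain ⟨y, hy, hy0⟩ : ∃ y ∈ coneShell K a b,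
      halfBoxCorr (y * mixedEmbedding K (α : K)) ≠ 0 := by
    contrapose! h
    rw [setLIntegral_congr_fun (measurableSet_coneShell _ b) h, lintegral_zero]
  have hN := norm_le_one_of_halfBoxCorr_ne_zero hy0
  rw [map_mul, norm_mixedEmbedding_algebraicInt] at hN
  rw [← one_div, le_div_iff₀' ha]
  exact (mul_le_mul_of_nonneg_right hy.2.1.le (Nat.cast_nonneg _)).trans hN

/-- The sum over a nonzero ideal `J` is dominated by the sum over the units and over chosen
generators of the principal multiples of `J`. -/
theorem tsum_idealLattice_le {J : (Ideal (𝓞 K))⁰} {S : Type*} {β : S → 𝓞 K}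
    {f : mixedSpace K → ℝ≥0∞}
    (hf : ∀ α ∈ (J : Ideal (𝓞 K)), f (mixedEmbedding K (α : K)) ≠ 0 →
      ∃ 𝔫 : S, Ideal.span {β 𝔫} = Ideal.span {α})
    (hβ : ∀ 𝔫, β 𝔫 ∈ (J : Ideal (𝓞 K))) :
    ∑' l : mixedEmbedding.idealLattice K (FractionalIdeal.mk0 K J), f l ≤
      ∑' 𝔫 : S, ∑' u : (𝓞 K)ˣ, f (mixedEmbedding K ((u : 𝓞 K) * β 𝔫 : 𝓞 K)) := by
  let Φ : S × (𝓞 K)ˣ → mixedEmbedding.idealLattice K (FractionalIdeal.mk0 K J) := fun p =>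
    ⟨mixedEmbedding K ((p.2 : 𝓞 K) * β p.1 : 𝓞 K), mem_idealLattice_mk0.2
      ⟨(p.2 : 𝓞 K) * β p.1, Ideal.mul_mem_left _ _ (hβ p.1), rfl⟩⟩
  have hsupp : Function.support (fun l : mixedEmbedding.idealLattice K (FractionalIdeal.mk0 K J) =>
      f l) ⊆ Set.range Φ := by
    rintro ⟨l, hl⟩ hfl
    obtain ⟨α, hα, rfl⟩ := mem_idealLattice_mk0.1 hl
    obtain ⟨𝔫, h𝔫⟩ := hf α hα hfl
    obtain ⟨u, hu⟩ := Ideal.span_singleton_eq_span_singleton.1 h𝔫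
    refine ⟨(𝔫, u), Subtype.ext ?_⟩
    change mixedEmbedding K ((u : 𝓞 K) * β 𝔫 : 𝓞 K) = _
    rw [mul_comm, hu]
  rw [← tsum_subtype_eq_of_support_subset hsupp, ← ENNReal.tsum_prod]
  exact ENNReal.tsum_le_tsum_comp_of_surjective Set.rangeFactorization_surjective
    fun l : Set.range Φ => f l.1

theorem tsum_setLIntegral_idealLattice_le (J : (Ideal (𝓞 K))⁰) {x b : ℝ} (hx : 0 < x) :
    (∑' l : mixedEmbedding.idealLattice K (FractionalIdeal.mk0 K J),
        if (l : mixedSpace K) = 0 then 0 else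
          ∫⁻ y in coneShell K (x * Ideal.absNorm (J : Ideal (𝓞 K)))⁻¹ b,
            halfBoxCorr (y * (l : mixedSpace K))) ≤
      Units.torsionOrder K * volume (halfBox K) ^ 2 *
        ENNReal.ofReal (Ideal.absNorm (J : Ideal (𝓞 K)) : ℝ)⁻¹ *
        ∑' 𝔫 : {I : Ideal (𝓞 K) // (I ≠ ⊥ ∧ (Ideal.absNorm I : ℝ) ≤ x) ∧
            (I * (J : Ideal (𝓞 K))).IsPrincipal},
          ENNReal.ofReal (Ideal.absNorm 𝔫.1 : ℝ)⁻¹ := by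
  have hJ0 : (J : Ideal (𝓞 K)) ≠ ⊥ := nonZeroDivisors.coe_ne_zero J
  have hJ : 0 < (Ideal.absNorm (J : Ideal (𝓞 K)) : ℝ) :=
    Nat.cast_pos.2 (Nat.pos_of_ne_zero (mt Ideal.absNorm_eq_zero_iff.1 hJ0))
  choose β hβ using fun 𝔫 : {I : Ideal (𝓞 K) // (I ≠ ⊥ ∧ (Ideal.absNorm I : ℝ) ≤ x) ∧
    (I * (J : Ideal (𝓞 K))).IsPrincipal} => 𝔫.2.2.principal
  simp only [Ideal.submodule_span_eq] at hβ
  refine (tsum_idealLattice_le (β := β) (f := fun z : mixedSpace K => if z = 0 then 0 else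
      ∫⁻ y in coneShell K (x * Ideal.absNorm (J : Ideal (𝓞 K)))⁻¹ b, halfBoxCorr (y * z))
      (fun α hα hfα => ?_) fun 𝔫 => ?_).trans ?_
  · simp only [ne_eq, ite_eq_left_iff, not_forall] at hfα
    obtain ⟨hα0, hint⟩ := hfα
    have hN := norm_mul_le_of_setLIntegral_ne_zero (by positivity) hint
    rw [inv_inv] at hN
    obtain ⟨𝔫, h𝔫, h𝔫J⟩ := exists_mul_eq_span_singleton hJ0 hα
      (fun h => hα0 (by rw [h, RingOfIntegers.coe_eq_algebraMap, map_zero, map_zero])) hN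
    exact ⟨⟨𝔫, h𝔫, ⟨α, h𝔫J⟩⟩, (hβ _).symm.trans h𝔫J⟩
  · have h := Ideal.mem_span_singleton_self (β 𝔫)
    rw [← hβ 𝔫] at h
    exact Ideal.mul_le_right h
  · rw [← ENNReal.tsum_mul_left]
    refine ENNReal.tsum_le_tsum fun 𝔫 => ?_
    have hβ0 : β 𝔫 ≠ 0 := by
      intro h
      have h' := hβ 𝔫
      rw [h, Ideal.span_singleton_zero, Ideal.mul_eq_bot] at h'
      exact h'.elim 𝔫.2.1.1 hJ0
    calc _ ≤ ∑' u : (𝓞 K)ˣ, ∫⁻ y in fundamentalCone K,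
            halfBoxCorr (y * mixedEmbedding K ((u : 𝓞 K) * β 𝔫 : 𝓞 K)) := by
          refine ENNReal.tsum_le_tsum fun u => ?_
          split_ifs
          · exact zero_le
          · exact lintegral_mono_set Set.inter_subset_left
      _ ≤ _ := tsum_setLIntegral_halfBoxCorr_le hβ0
      _ = _ := by
        rw [← hβ 𝔫, map_mul, Nat.cast_mul, mul_inv, ENNReal.ofReal_mul (by positivity)]
        ring

theorem finite_ideal_ne_bot_absNorm_le (K : Type*) [Field K] [NumberField K] (x : ℝ) :
    {I : Ideal (𝓞 K) | I ≠ ⊥ ∧ (Ideal.absNorm I : ℝ) ≤ x}.Finite :=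
  (Ideal.finite_setOfPred_absNorm_le (S := 𝓞 K) ⌊x⌋₊).subset fun _ hI => Nat.le_floor hI.2

theorem volume_normLeOne_mul_log_le_harmonic_sum (J : (Ideal (𝓞 K))⁰) {x a b : ℝ} (hx : 0 < x)
    (ha : a = (x * Ideal.absNorm (J : Ideal (𝓞 K)))⁻¹) (hab : a ≤ b) :
    volume (fundamentalCone.normLeOne K) *
        ENNReal.ofReal (Real.log (b / a)) *
        volume (halfBox K) ^ 2 ≤
      ENNReal.ofReal
          (ZLattice.covolume (mixedEmbedding.idealLattice K (FractionalIdeal.mk0 K J))) *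
        (volume (halfBox K) * (volume (fundamentalCone.normLeOne K) * ENNReal.ofReal b) +
          Units.torsionOrder K * volume (halfBox K) ^ 2 *
            ENNReal.ofReal (Ideal.absNorm (J : Ideal (𝓞 K)) : ℝ)⁻¹ *
            ∑' 𝔫 : {I : Ideal (𝓞 K) // (I ≠ ⊥ ∧ (Ideal.absNorm I : ℝ) ≤ x) ∧
                (I * (J : Ideal (𝓞 K))).IsPrincipal},
              ENNReal.ofReal (Ideal.absNorm 𝔫.1 : ℝ)⁻¹) := by
  have hJ : 0 < (Ideal.absNorm (J : Ideal (𝓞 K)) : ℝ) :=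
    Nat.cast_pos.2 (Nat.pos_of_ne_zero
      (mt Ideal.absNorm_eq_zero_iff.1 (nonZeroDivisors.coe_ne_zero J)))
  refine (volume_normLeOne_mul_log_le (ha ▸ by positivity) hab (FractionalIdeal.mk0 K J)).trans ?_
  refine mul_le_mul_right (add_le_add_right ?_ _) _
  rw [ha]
  exact tsum_setLIntegral_idealLattice_le J hx

set_option maxHeartbeats 400000 in
theorem class_harmonic_sum_lower_bound (J : (Ideal (𝓞 K))⁰) {x : ℝ} (hx : √|(discr K : ℝ)| ≤ x) :
    2 ^ nrRealPlaces K * (2 * Real.pi) ^ nrComplexPlaces K * Units.regulator K /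
        (Units.torsionOrder K * √|(discr K : ℝ)|) *
        (Real.log x - Real.log |(discr K : ℝ)| / 2 - 1) ≤
      ∑' 𝔫 : {I : Ideal (𝓞 K) // (I ≠ ⊥ ∧ (Ideal.absNorm I : ℝ) ≤ x) ∧
          (I * (J : Ideal (𝓞 K))).IsPrincipal}, (Ideal.absNorm 𝔫.1 : ℝ)⁻¹ := by
  have hJ0 : (J : Ideal (𝓞 K)) ≠ ⊥ := nonZeroDivisors.coe_ne_zero J
  have hJ : 0 < (Ideal.absNorm (J : Ideal (𝓞 K)) : ℝ) :=
    Nat.cast_pos.2 (Nat.pos_of_ne_zero (mt Ideal.absNorm_eq_zero_iff.1 hJ0))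
  have hd : 0 < |(discr K : ℝ)| := abs_pos.2 (Int.cast_ne_zero.2 (discr_ne_zero K))
  have hs : 0 < √|(discr K : ℝ)| := Real.sqrt_pos.2 hd
  have hx0 : 0 < x := hs.trans_le hx
  have hw : 0 < (Units.torsionOrder K : ℝ) := Nat.cast_pos.2 (Units.torsionOrder_pos K)
  have hR := Units.regulator_pos K
  have hπ := Real.pi_pos
  have : Finite {I : Ideal (𝓞 K) // (I ≠ ⊥ ∧ (Ideal.absNorm I : ℝ) ≤ x) ∧
      (I * (J : Ideal (𝓞 K))).IsPrincipal} :=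
    ((finite_ideal_ne_bot_absNorm_le K x).subset fun I hI => hI.1).to_subtype
  set T := ∑' 𝔫 : {I : Ideal (𝓞 K) // (I ≠ ⊥ ∧ (Ideal.absNorm I : ℝ) ≤ x) ∧
          (I * (J : Ideal (𝓞 K))).IsPrincipal}, (Ideal.absNorm 𝔫.1 : ℝ)⁻¹ with hT
  have hT0 : 0 ≤ T := tsum_nonneg fun 𝔫 => by positivity
  obtain ⟨V, hV⟩ : ∃ V : ℝ, V = (Real.pi / 4) ^ nrComplexPlaces K := ⟨_, rfl⟩
  have hV0 : 0 < V := by rw [hV]; positivity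
  obtain ⟨A, hA⟩ : ∃ A : ℝ, A =
      2 ^ nrRealPlaces K * Real.pi ^ nrComplexPlaces K * Units.regulator K :=
    ⟨_, rfl⟩
  have hA0 : 0 < A := by rw [hA]; positivity
  obtain ⟨c, hc⟩ : ∃ c : ℝ, c =
      Ideal.absNorm (J : Ideal (𝓞 K)) * (2⁻¹) ^ nrComplexPlaces K * √|(discr K : ℝ)| :=
    ⟨_, rfl⟩
  have hc0 : 0 < c := by rw [hc]; positivity
  have hcov : ZLattice.covolume (mixedEmbedding.idealLattice K (FractionalIdeal.mk0 K J)) = c := by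
    rw [covolume_idealLattice, FractionalIdeal.coe_mk0, FractionalIdeal.coeIdeal_absNorm]
    push_cast
    exact hc.symm
  have hvol : volume (fundamentalCone.normLeOne K) = ENNReal.ofReal A := by
    rw [fundamentalCone.volume_normLeOne, hA, ENNReal.ofReal_mul (by positivity),
      ENNReal.ofReal_mul (by positivity), ENNReal.ofReal_pow (by positivity),
      ENNReal.ofReal_pow (by positivity), ENNReal.ofReal_ofNat, ← NNReal.coe_real_pi,
      ENNReal.ofReal_coe_nnreal]
  obtain ⟨a, ha⟩ : ∃ a : ℝ, a = (x * Ideal.absNorm (J : Ideal (𝓞 K)))⁻¹ := ⟨_, rfl⟩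
  have ha0 : 0 < a := by rw [ha]; positivity
  have hba : V / c / a = (Real.pi / 2) ^ nrComplexPlaces K * (x / √|(discr K : ℝ)|) := by
    rw [hV, hc, ha, show Real.pi / 4 = Real.pi / 2 * 2⁻¹ by ring, mul_pow]
    field_simp
  have hpi : 1 ≤ (Real.pi / 2) ^ nrComplexPlaces K :=
    one_le_pow₀ (by linarith [Real.two_le_pi])
  have hxs : x / √|(discr K : ℝ)| ≤ V / c / a := by
    rw [hba]
    exact le_mul_of_one_le_left (by positivity) hpi
  have hxs1 : 1 ≤ x / √|(discr K : ℝ)| := (one_le_div hs).2 hx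
  have hab : a ≤ V / c := (one_le_div ha0).1 (hxs1.trans hxs)
  have key := volume_normLeOne_mul_log_le_harmonic_sum J hx0 ha hab
  rw [← ENNReal.ofReal_tsum_of_nonneg (fun 𝔫 => by positivity) (Summable.of_finite), ← hT, hcov,
    hvol, volume_halfBox, ← hV, ← ENNReal.ofReal_natCast (Units.torsionOrder K)] at key
  have hlog : 0 ≤ Real.log (V / c / a) := Real.log_nonneg (hxs1.trans hxs)
  rw [← ENNReal.ofReal_mul hA0.le, ← ENNReal.ofReal_pow hV0.le,
    ← ENNReal.ofReal_mul (by positivity), ← ENNReal.ofReal_mul hA0.le,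
    ← ENNReal.ofReal_mul hV0.le, ← ENNReal.ofReal_mul hw.le, ← ENNReal.ofReal_mul (by positivity),
    ← ENNReal.ofReal_mul (by positivity), ← ENNReal.ofReal_add (by positivity) (by positivity),
    ← ENNReal.ofReal_mul hc0.le, ENNReal.ofReal_le_ofReal_iff (by positivity)] at key
  have hlog' : Real.log x - Real.log |(discr K : ℝ)| / 2 ≤ Real.log (V / c / a) := by
    rw [← Real.log_sqrt hd.le, ← Real.log_div hx0.ne' hs.ne']
    exact Real.log_le_log (by positivity) hxs
  have key' : A * (Real.log (V / c / a) - 1) ≤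
      Units.torsionOrder K * ((2⁻¹) ^ nrComplexPlaces K * √|(discr K : ℝ)|) * T := by
    have h : c * (V * (A * (V / c)) + Units.torsionOrder K * V ^ 2 *
        (Ideal.absNorm (J : Ideal (𝓞 K)) : ℝ)⁻¹ * T) = V ^ 2 * (A +
        Units.torsionOrder K * ((2⁻¹) ^ nrComplexPlaces K * √|(discr K : ℝ)|) * T) := by
      rw [mul_add, mul_add]
      congr 1
      · field_simp
      · rw [hc]
        field_simp
    rw [h, mul_comm _ (V ^ 2), mul_le_mul_iff_right₀ (by positivity)] at key
    linarith
  rw [div_mul_eq_mul_div, div_le_iff₀ (by positivity)]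
  have h2 : (2 : ℝ) ^ nrComplexPlaces K * (2⁻¹) ^ nrComplexPlaces K = 1 := by
    rw [← mul_pow]; norm_num
  calc _ = 2 ^ nrComplexPlaces K * (A * (Real.log x - Real.log |(discr K : ℝ)| / 2 - 1)) := by
        rw [hA, mul_pow]; ring
    _ ≤ 2 ^ nrComplexPlaces K * (Units.torsionOrder K *
          ((2⁻¹) ^ nrComplexPlaces K * √|(discr K : ℝ)|) * T) := by
        refine mul_le_mul_of_nonneg_left (le_trans ?_ key') (by positivity)
        gcongr
    _ = (2 ^ nrComplexPlaces K * (2⁻¹) ^ nrComplexPlaces K) *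
          (T * (Units.torsionOrder K * √|(discr K : ℝ)|)) := by ring
    _ = _ := by rw [h2, one_mul]

theorem harmonic_sum_ge_dedekindZeta_residue_mul {x : ℝ} (hx : √|(discr K : ℝ)| ≤ x) :
    dedekindZeta_residue K * (Real.log x - Real.log |(discr K : ℝ)| / 2 - 1) ≤
      ∑' 𝔫 : {I : Ideal (𝓞 K) // I ≠ ⊥ ∧ (Ideal.absNorm I : ℝ) ≤ x},
        1 / (Ideal.absNorm 𝔫.1 : ℝ) := by
  have : Finite {I : Ideal (𝓞 K) // I ≠ ⊥ ∧ (Ideal.absNorm I : ℝ) ≤ x} :=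
    (finite_ideal_ne_bot_absNorm_le K x).to_subtype
  let cl : {I : Ideal (𝓞 K) // I ≠ ⊥ ∧ (Ideal.absNorm I : ℝ) ≤ x} → ClassGroup (𝓞 K) :=
    fun 𝔫 => ClassGroup.mk0 ⟨𝔫.1, mem_nonZeroDivisors_iff_ne_zero.2 𝔫.2.1⟩
  have hsum : Summable fun 𝔫 : {I : Ideal (𝓞 K) // I ≠ ⊥ ∧ (Ideal.absNorm I : ℝ) ≤ x} =>
    1 / (Ideal.absNorm 𝔫.1 : ℝ) := Summable.of_finite
  rw [← (hsum.hasSum.tsum_fiberwise cl).tsum_eq, tsum_fintype]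
  set B : ℝ := 2 ^ nrRealPlaces K * (2 * Real.pi) ^ nrComplexPlaces K * Units.regulator K /
        (Units.torsionOrder K * √|(discr K : ℝ)|) *
        (Real.log x - Real.log |(discr K : ℝ)| / 2 - 1) with hB
  have hcl (C : ClassGroup (𝓞 K)) : B ≤ ∑' 𝔫 : cl ⁻¹' {C}, 1 / (Ideal.absNorm 𝔫.1.1 : ℝ) := by
    obtain ⟨J, hJ⟩ := ClassGroup.mk0_surjective C⁻¹
    have hiff (𝔫 : {I : Ideal (𝓞 K) // I ≠ ⊥ ∧ (Ideal.absNorm I : ℝ) ≤ x}) :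
        (𝔫.1 * (J : Ideal (𝓞 K))).IsPrincipal ↔ cl 𝔫 = C := by
      rw [← ClassGroup.mk0_eq_one_iff (mul_mem (mem_nonZeroDivisors_iff_ne_zero.2 𝔫.2.1) J.2),
        ← mul_inv_eq_one (a := cl 𝔫), ← hJ, ← map_mul]
      rfl
    let e : cl ⁻¹' {C} ≃ {I : Ideal (𝓞 K) // (I ≠ ⊥ ∧ (Ideal.absNorm I : ℝ) ≤ x) ∧
        (I * (J : Ideal (𝓞 K))).IsPrincipal} :=
      { toFun := fun 𝔫 => ⟨𝔫.1.1, 𝔫.1.2, (hiff 𝔫.1).2 𝔫.2⟩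
        invFun := fun 𝔫 => ⟨⟨𝔫.1, 𝔫.2.1⟩, (hiff ⟨𝔫.1, 𝔫.2.1⟩).1 𝔫.2.2⟩
        left_inv := fun _ => rfl
        right_inv := fun _ => rfl }
    refine (class_harmonic_sum_lower_bound J hx).trans_eq ?_
    rw [← e.tsum_eq]
    exact tsum_congr fun 𝔫 => (one_div _).symm
  refine le_trans (le_of_eq ?_) (Finset.card_nsmul_le_sum Finset.univ _ B fun C _ => hcl C)
  rw [dedekindZeta_residue_def, nsmul_eq_mul, Finset.card_univ, hB, classNumber]
  ring

end ScaledLattice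

theorem tsum_absNorm_rpow_eq_dedekindZeta (K : Type*) [Field K] [NumberField K] (σ : ℝ) :
    ((∑' 𝔞 : {I : Ideal (𝓞 K) // I ≠ ⊥}, (Ideal.absNorm 𝔞.1 : ℝ) ^ (-σ) : ℝ) : ℂ) =
      dedekindZeta K σ := by
  have hterm (n : ℕ) : LSeries.term
      (fun n => (Nat.card {I : Ideal (𝓞 K) // Ideal.absNorm I = n} : ℂ)) σ n =
      ((∑' 𝔞 : (fun 𝔞 : {I : Ideal (𝓞 K) // I ≠ ⊥} => Ideal.absNorm 𝔞.1) ⁻¹' {n},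
        ENNReal.ofReal ((Ideal.absNorm 𝔞.1.1 : ℝ) ^ (-σ))).toReal : ℂ) := by
    have h (𝔞 : (fun 𝔞 : {I : Ideal (𝓞 K) // I ≠ ⊥} => Ideal.absNorm 𝔞.1) ⁻¹' {n}) :
        ENNReal.ofReal ((Ideal.absNorm 𝔞.1.1 : ℝ) ^ (-σ)) = ENNReal.ofReal ((n : ℝ) ^ (-σ)) := by
      rw [show Ideal.absNorm 𝔞.1.1 = n from 𝔞.2]
    rw [tsum_congr h, ENNReal.tsum_toReal_eq fun _ => ENNReal.ofReal_ne_top, tsum_const,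
      ENNReal.toReal_ofReal (by positivity)]
    rcases eq_or_ne n 0 with rfl | hn
    · have : IsEmpty ((fun 𝔞 : {I : Ideal (𝓞 K) // I ≠ ⊥} => Ideal.absNorm 𝔞.1) ⁻¹' {0}) :=
        ⟨fun 𝔞 => 𝔞.1.2 (Ideal.absNorm_eq_zero_iff.1 𝔞.2)⟩
      simp
    · rw [LSeries.term_of_ne_zero hn, nsmul_eq_mul, div_eq_mul_inv, ← Complex.cpow_neg]
      push_cast
      rw [Complex.ofReal_cpow (Nat.cast_nonneg n), Complex.ofReal_neg, Complex.ofReal_natCast]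
      congr 2
      exact Nat.card_congr
        { toFun := fun I => ⟨⟨I.1, fun h => hn (I.2.symm.trans (by rw [h, Ideal.absNorm_bot]))⟩,
            I.2⟩
          invFun := fun I => ⟨I.1.1, I.2⟩
          left_inv := fun _ => rfl
          right_inv := fun _ => rfl }
  have hfin (n : ℕ) : ∑' 𝔞 : (fun 𝔞 : {I : Ideal (𝓞 K) // I ≠ ⊥} => Ideal.absNorm 𝔞.1) ⁻¹' {n},
      ENNReal.ofReal ((Ideal.absNorm 𝔞.1.1 : ℝ) ^ (-σ)) ≠ ⊤ := by
    have : Finite ((fun 𝔞 : {I : Ideal (𝓞 K) // I ≠ ⊥} => Ideal.absNorm 𝔞.1) ⁻¹' {n}) :=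
      ((Ideal.finite_setOfPred_absNorm_eq (S := 𝓞 K) n).preimage
        Subtype.val_injective.injOn).to_subtype
    have := Fintype.ofFinite ((fun 𝔞 : {I : Ideal (𝓞 K) // I ≠ ⊥} => Ideal.absNorm 𝔞.1) ⁻¹' {n})
    rw [tsum_fintype]
    exact ENNReal.sum_ne_top.2 fun _ _ => ENNReal.ofReal_ne_top
  rw [dedekindZeta, LSeries, tsum_congr hterm, ← Complex.ofReal_tsum,
    ← ENNReal.tsum_toReal_eq hfin, ENNReal.tsum_fiberwise
      (fun 𝔞 : {I : Ideal (𝓞 K) // I ≠ ⊥} => ENNReal.ofReal ((Ideal.absNorm 𝔞.1 : ℝ) ^ (-σ))),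
    ENNReal.tsum_toReal_eq fun _ => ENNReal.ofReal_ne_top]
  refine congrArg _ (tsum_congr fun 𝔞 => ?_)
  rw [ENNReal.toReal_ofReal (by positivity)]

theorem IsResidue.eq_dedekindZeta_residue {κ : ℝ} (hκ : IsResidue K κ) :
    κ = dedekindZeta_residue K := by
  refine Complex.ofReal_injective (tendsto_nhds_unique ?_
    (tendsto_sub_one_mul_dedekindZeta_nhdsGT K))
  refine (Complex.continuous_ofReal.continuousAt.tendsto.comp hκ).congr fun σ => ?_
  rw [← tsum_absNorm_rpow_eq_dedekindZeta]
  simp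

/-- **Lower bound for the harmonic sum over ideals** (Corollary 2.9). For `η > 0` there are
`C₁ = C₁(η) ≥ 3` sufficiently large, an `e^{O_η(n_K)}`-constant `C₂`, and `c = c(η) > 0`,
such that if `x ≥ C₁ e^{C₂ n_K} (n_K^{n_K} D_K)^{1/2+η}` then
`Σ_{N𝔫 ≤ x} 1/N𝔫 ≥ c κ_K log x`. -/
theorem harmonic_sum_lower_bound :
    ∀ η : ℝ, 0 < η →
    ∃ C₁ C₂ c : ℝ, 3 ≤ C₁ ∧ 0 < C₂ ∧ 0 < c ∧
      ∀ (K : Type) [Field K] [NumberField K] (κ x : ℝ),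
        IsResidue K κ →
        C₁ * Real.exp (C₂ * (nK K : ℝ)) *
            ((nK K : ℝ) ^ (nK K) * (DK K : ℝ)) ^ ((1 : ℝ) / 2 + η) ≤ x →
        c * (κ * Real.log x) ≤
          ∑' 𝔫 : {I : Ideal (𝓞 K) // I ≠ ⊥ ∧ (Ideal.absNorm I : ℝ) ≤ x},
            1 / (Ideal.absNorm 𝔫.1 : ℝ) := by
  intro η hη
  refine ⟨3 * Real.exp (1 + 2 * η), 1, 2 * η / (1 + 2 * η), ?_, one_pos, by positivity, ?_⟩
  · linarith [Real.one_le_exp (show 0 ≤ 1 + 2 * η by positivity)]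
  intro K _ _ κ x hκ hx
  rw [hκ.eq_dedekindZeta_residue]
  have hd : |(discr K : ℝ)| = DK K := by rw [DK, Nat.cast_natAbs, Int.cast_abs]
  have hd' : (1 : ℝ) ≤ DK K :=
    Nat.one_le_cast.2 (Nat.one_le_iff_ne_zero.2 (Int.natAbs_ne_zero.2 (discr_ne_zero K)))
  have hd0 : (0 : ℝ) < DK K := by linarith
  have hn' : (1 : ℝ) ≤ (nK K : ℝ) ^ nK K := one_le_pow₀ (Nat.one_le_cast.2 Module.finrank_pos)
  have hle : Real.exp (1 + 2 * η) * (DK K : ℝ) ^ ((1 : ℝ) / 2 + η) ≤ x := by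
    refine le_trans ?_ hx
    refine mul_le_mul ?_ (Real.rpow_le_rpow hd0.le ?_ (by positivity)) (by positivity)
      (by positivity)
    · rw [mul_assoc, mul_left_comm]
      refine le_mul_of_one_le_right (by positivity) ?_
      linarith [Real.one_le_exp (show 0 ≤ 1 * (nK K : ℝ) by positivity)]
    · exact le_mul_of_one_le_left hd0.le hn'
  have hx0 : 0 < x := lt_of_lt_of_le (by positivity) hle
  have hlog : 1 + 2 * η + (1 / 2 + η) * Real.log (DK K) ≤ Real.log x := by
    rw [← Real.log_rpow hd0, ← Real.log_exp (1 + 2 * η), ← Real.log_mul (by positivity)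
      (by positivity)]
    exact Real.log_le_log (by positivity) (by simpa using hle)
  refine le_trans ?_ (harmonic_sum_ge_dedekindZeta_residue_mul ?_) <;> rw [hd]
  · rw [mul_left_comm]
    refine mul_le_mul_of_nonneg_left ?_ (dedekindZeta_residue_pos K).le
    rw [div_mul_eq_mul_div, div_le_iff₀ (by positivity)]
    linarith
  · refine le_trans ?_ hle
    rw [Real.sqrt_eq_rpow]
    refine (Real.rpow_le_rpow_of_exponent_le hd' (le_add_of_nonneg_right hη.le)).trans ?_
    exact le_mul_of_one_le_left (by positivity) (Real.one_le_exp (by positivity))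

end RTZ
end
end

section
/- For y ≥ 2, Σ_{N𝔫 ≤ y} Λ_K(𝔫)/N𝔫 ≪ log(D_K · y), where the sum runs over the nonzero integral ideals 𝔫 of K. -/
open scoped BigOperators
open Complex NumberField Filter Topology

noncomputable section

namespace RTZ

variable {K : Type*} [Field K] [NumberField K]

section GaussianLattice

open MeasureTheory Submodule
open scoped ENNReal

/-- A positive definite quadratic form on a finite dimensional real space, presented through the
identity that completes the square in a product of two Gaussians. -/
structure IsGaussForm {V : Type*} [NormedAddCommGroup V] [NormedSpace ℝ V] (Q : V → ℝ) : Prop where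
  continuous : Continuous Q
  smul : ∀ (c : ℝ) (x : V), Q (c • x) = c ^ 2 * Q x
  square : ∀ (a b : ℝ) (x z : V), a + b ≠ 0 →
    a * Q x + b * Q (z - x) = (a + b) * Q (x - (b / (a + b)) • z) + a * b / (a + b) * Q z
  coercive : ∃ c > 0, ∀ x, c * ‖x‖ ^ 2 ≤ Q x

/-- The Gaussian `exp (-s Q x)`, with values in `ℝ≥0∞`. -/
def gauss {V : Type*} (Q : V → ℝ) (s : ℝ) (x : V) : ℝ≥0∞ := ENNReal.ofReal (Real.exp (-s * Q x))

lemma gauss_mul {V : Type*} {Q : V → ℝ} (s : ℝ) (x y : V) (t : ℝ) :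
    gauss Q s x * gauss Q t y = ENNReal.ofReal (Real.exp (-(s * Q x + t * Q y))) := by
  rw [gauss, gauss, ← ENNReal.ofReal_mul (Real.exp_pos _).le, ← Real.exp_add]
  ring_nf

lemma measurable_gauss {V : Type*} [TopologicalSpace V] [MeasurableSpace V]
    [OpensMeasurableSpace V] {Q : V → ℝ} (hQ : Continuous Q) (s : ℝ) :
    Measurable (gauss Q s) := by
  unfold gauss
  fun_prop

/-- The theta series of the lattice spanned by `b` with respect to `Q`. -/
def theta {V ι : Type*} [NormedAddCommGroup V] [NormedSpace ℝ V] (b : Module.Basis ι ℝ V)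
    (Q : V → ℝ) (s : ℝ) : ℝ≥0∞ :=
  ∑' v : span ℤ (Set.range b), gauss Q s v

/-- The theta series shifted by `z`. -/
def thetaShift {V ι : Type*} [NormedAddCommGroup V] [NormedSpace ℝ V] (b : Module.Basis ι ℝ V)
    (Q : V → ℝ) (s : ℝ) (z : V) : ℝ≥0∞ :=
  ∑' v : span ℤ (Set.range b), gauss Q s (v + z)

variable {V ι : Type*} [NormedAddCommGroup V] [NormedSpace ℝ V] {b : Module.Basis ι ℝ V}
  {Q : V → ℝ}

lemma thetaShift_zero (s : ℝ) : thetaShift b Q s 0 = theta b Q s := by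
  simp [thetaShift, theta]

lemma IsGaussForm.neg (hQ : IsGaussForm Q) (x : V) : Q (-x) = Q x := by
  simpa using hQ.smul (-1) x

lemma IsGaussForm.gauss_neg (hQ : IsGaussForm Q) (s : ℝ) (x : V) :
    gauss Q s (-x) = gauss Q s x := by
  rw [gauss, gauss, hQ.neg]

lemma IsGaussForm.zero (hQ : IsGaussForm Q) : Q 0 = 0 := by
  simpa using hQ.smul 0 0

lemma IsGaussForm.nonneg (hQ : IsGaussForm Q) (x : V) : 0 ≤ Q x := by
  obtain ⟨c, hc, h⟩ := hQ.coercive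
  exact le_trans (by positivity) (h x)

lemma thetaShift_add (s : ℝ) (v : span ℤ (Set.range b)) (z : V) :
    thetaShift b Q s (v + z) = thetaShift b Q s z := by
  rw [thetaShift, thetaShift, ← (Equiv.addRight v).tsum_eq (fun u ↦ gauss Q s (u + z))]
  simp [add_assoc]

lemma IsGaussForm.thetaShift_neg (hQ : IsGaussForm Q) (s : ℝ) (z : V) :
    thetaShift b Q s (-z) = thetaShift b Q s z := by
  rw [thetaShift, thetaShift, ← (Equiv.neg _).tsum_eq]
  refine tsum_congr fun v ↦ ?_
  rw [← hQ.gauss_neg]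
  simp [add_comm]

lemma exp_neg_sq_le (c : ℝ) (hc : 0 < c) (k : ℕ) (t : ℝ) (ht : 0 ≤ t) :
    Real.exp (-c * t ^ 2) ≤ k.factorial * Real.exp (1 + 1 / (4 * c)) * (1 + t) ^ (-(k : ℝ)) := by
  rw [Real.rpow_neg (by positivity), ← div_eq_mul_inv, le_div_iff₀ (by positivity),
    Real.rpow_natCast]
  have h1 : (1 + t) ^ k ≤ k.factorial * Real.exp (1 + t) := by
    have := Real.pow_div_factorial_le_exp (1 + t) (by positivity) k
    rwa [div_le_iff₀' (by positivity)] at this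
  have h2 : -c * t ^ 2 + (1 + t) ≤ 1 + 1 / (4 * c) := by
    have : 1 / (4 * c) + c * t ^ 2 - t = c * (t - 1 / (2 * c)) ^ 2 := by
      field_simp
      ring
    nlinarith [mul_nonneg hc.le (sq_nonneg (t - 1 / (2 * c)))]
  calc _ ≤ Real.exp (-c * t ^ 2) * (k.factorial * Real.exp (1 + t)) := by gcongr
    _ = k.factorial * Real.exp (-c * t ^ 2 + (1 + t)) := by
        rw [Real.exp_add (-c * t ^ 2) (1 + t)]
        ring
    _ ≤ _ := by gcongr

variable [FiniteDimensional ℝ V] [MeasurableSpace V] [BorelSpace V] (μ : Measure V)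
  [μ.IsAddHaarMeasure]

lemma lintegral_gauss_lt_top (hQ : IsGaussForm Q) {s : ℝ} (hs : 0 < s) :
    ∫⁻ x, gauss Q s x ∂μ < ∞ := by
  obtain ⟨c, hc, h⟩ := hQ.coercive
  set k := Module.finrank ℝ V + 1
  have hint : Integrable (fun x : V ↦ k.factorial * Real.exp (1 + 1 / (4 * (s * c))) *
      (1 + ‖x‖) ^ (-(k : ℝ))) μ :=
    (integrable_one_add_norm (by simp [k])).const_mul _
  refine lt_of_le_of_lt (lintegral_mono fun x ↦ ?_) hint.lintegral_lt_top
  refine ENNReal.ofReal_le_ofReal (le_trans ?_ (exp_neg_sq_le (s * c) (by positivity) k ‖x‖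
    (norm_nonneg x)))
  exact Real.exp_le_exp.mpr (by nlinarith [h x])

omit [NormedSpace ℝ V] [FiniteDimensional ℝ V] in
lemma lintegral_gauss_pos (hQ : Continuous Q) (s : ℝ) : 0 < ∫⁻ x, gauss Q s x ∂μ := by
  rw [lintegral_pos_iff_support (measurable_gauss hQ s)]
  have : Function.support (gauss Q s) = Set.univ := by
    ext x
    simp [gauss, Real.exp_pos]
  rw [this]
  exact (NeZero.ne (μ Set.univ)).bot_lt

lemma lintegral_gauss_scale (hQ : IsGaussForm Q) {s : ℝ} (hs : 0 < s) :
    ∫⁻ x, gauss Q s x ∂μ =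
      ENNReal.ofReal (s ^ (-(Module.finrank ℝ V / 2 : ℝ))) * ∫⁻ x, gauss Q 1 x ∂μ := by
  have h1 : ∀ x, gauss Q s x = gauss Q 1 (Real.sqrt s • x) := fun x ↦ by
    rw [gauss, gauss, hQ.smul, Real.sq_sqrt hs.le]
    ring_nf
  have hr : Real.sqrt s ≠ 0 := by positivity
  have h2 := Measure.map_addHaar_smul μ hr
  simp_rw [h1]
  rw [← lintegral_map (measurable_gauss hQ.continuous 1) (measurable_const_smul _), h2,
    lintegral_smul_measure, smul_eq_mul]
  congr 2
  rw [abs_of_pos (by positivity), Real.rpow_neg hs.le, Real.sqrt_eq_rpow, ← Real.rpow_natCast,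
    ← Real.rpow_mul hs.le]
  ring_nf

omit [FiniteDimensional ℝ V] in
lemma lintegral_gauss_conv (hQ : IsGaussForm Q) {s t : ℝ} (h : s + t ≠ 0) (z : V) :
    ∫⁻ x, gauss Q s x * gauss Q t (z - x) ∂μ =
      (∫⁻ x, gauss Q (s + t) x ∂μ) * gauss Q (s * t / (s + t)) z := by
  have hm : Measurable fun x ↦ gauss Q (s + t) (x - (t / (s + t)) • z) :=
    (measurable_gauss hQ.continuous _).comp (measurable_id.sub_const _)
  rw [← lintegral_sub_right_eq_self (gauss Q (s + t)) ((t / (s + t)) • z),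
    ← lintegral_mul_const _ hm]
  simp_rw [gauss_mul, hQ.square s t _ z h]

variable [Finite ι]

lemma lintegral_unfold {f g : V → ℝ≥0∞} (hf : Measurable f) (hg : Measurable g)
    (hper : ∀ (v : span ℤ (Set.range b)) (x : V), g (v + x) = g x) :
    ∫⁻ x, f x * g x ∂μ =
      ∫⁻ x in ZSpan.fundamentalDomain b, (∑' v : span ℤ (Set.range b), f (v + x)) * g x ∂μ := by
  have hF := ZSpan.isAddFundamentalDomain' b μ
  have : Countable (span ℤ (Set.range b)).toAddSubgroup := by
    change Countable (span ℤ (Set.range b))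
    infer_instance
  have hm (v : span ℤ (Set.range b)) : Measurable fun x : V ↦ f (v + x) * g x :=
    (hf.comp (measurable_const_add _)).mul hg
  have hper' (x : V) : (∑' v : span ℤ (Set.range b), f (v + x)) * g x =
      ∑' v : span ℤ (Set.range b), f (v + x) * g x := ENNReal.tsum_mul_right.symm
  simp_rw [hF.lintegral_eq_tsum'', hper']
  rw [lintegral_tsum fun v ↦ (hm v).aemeasurable]
  refine tsum_congr fun v ↦ lintegral_congr fun x ↦ ?_
  rw [← hper v x]
  rfl

lemma measurable_thetaShift (hQ : Continuous Q) (s : ℝ) : Measurable (thetaShift b Q s) := by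
  unfold thetaShift
  exact Measurable.tsum fun v ↦ (measurable_gauss hQ s).comp (measurable_const_add _)

lemma two_mul_mul_le_ennreal (a c : ℝ≥0∞) : 2 * (a * c) ≤ a * a + c * c := by
  induction a with
  | top => simp
  | coe a =>
    induction c with
    | top => simp
    | coe c =>
      norm_cast
      have := two_mul_le_add_sq a c
      simpa [sq, mul_assoc] using this

lemma thetaShift_le (hQ : IsGaussForm Q) {s : ℝ} (hs : 0 < s) (z : V) :
    thetaShift b Q s z ≤ theta b Q s := by
  let μ : Measure V := Measure.addHaar
  obtain ⟨H, hH⟩ : ∃ H, H = thetaShift b Q (2 * s) := ⟨_, rfl⟩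
  have hHm : Measurable H := hH ▸ measurable_thetaShift hQ.continuous _
  have hG : Measurable (gauss Q (2 * s)) := measurable_gauss hQ.continuous _
  have hm (z : V) : Measurable fun x ↦ H (z - x) := hHm.comp (measurable_const.sub measurable_id)
  have hHper (z : V) (v : span ℤ (Set.range b)) (x : V) : H (z - (v + x)) = H (z - x) := by
    rw [show z - (v + x) = ((-v : span ℤ (Set.range b)) : V) + (z - x) by push_cast; abel]
    rw [hH, thetaShift_add]
  have key : ∀ z, (∫⁻ x, gauss Q (2 * s + 2 * s) x ∂μ) * thetaShift b Q s z =
      ∫⁻ x in ZSpan.fundamentalDomain b, H x * H (z - x) ∂μ := fun z ↦ by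
    have hHx (x : V) : H x = ∑' v : span ℤ (Set.range b), gauss Q (2 * s) (v + x) := by
      rw [hH, thetaShift]
    conv_rhs => enter [2, x]; rw [hHx x]
    rw [← lintegral_unfold (f := gauss Q (2 * s)) (g := fun x ↦ H (z - x)) μ hG (hm z)]
    · have : ∀ x, gauss Q (2 * s) x * H (z - x) = ∑' v : span ℤ (Set.range b),
          gauss Q (2 * s) x * gauss Q (2 * s) (v + z - x) := fun x ↦ by
        rw [hH, thetaShift, ENNReal.tsum_mul_left]
        simp_rw [add_sub_assoc]
      simp_rw [this]
      have hm' (v : span ℤ (Set.range b)) :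
          Measurable fun x ↦ gauss Q (2 * s) x * gauss Q (2 * s) (v + z - x) :=
        hG.mul (hG.comp (measurable_const.sub measurable_id))
      rw [lintegral_tsum fun v ↦ (hm' v).aemeasurable]
      simp_rw [lintegral_gauss_conv μ hQ (show 2 * s + 2 * s ≠ 0 by positivity)]
      rw [ENNReal.tsum_mul_left, thetaShift]
      have : 2 * s * (2 * s) / (2 * s + 2 * s) = s := by field_simp; ring
      rw [this]
    · exact hHper z
  have hsq : ∀ z, ∫⁻ x in ZSpan.fundamentalDomain b, H (z - x) * H (z - x) ∂μ =
      ∫⁻ x, gauss Q (2 * s) x * H x ∂μ := fun z ↦ by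
    rw [← lintegral_sub_left_eq_self (μ := μ) (fun x ↦ gauss Q (2 * s) x * H x) z]
    have hu := lintegral_unfold (b := b) (f := fun x ↦ gauss Q (2 * s) (z - x))
      (g := fun x ↦ H (z - x)) μ (hG.comp (measurable_const.sub measurable_id)) (hm z) (hHper z)
    refine Eq.trans (lintegral_congr fun x ↦ ?_) hu.symm
    refine congrArg (· * H (z - x)) ?_
    rw [hH, thetaShift, ← (Equiv.neg _).tsum_eq]
    refine tsum_congr fun v ↦ congrArg (gauss Q (2 * s)) ?_
    simp only [Equiv.neg_apply, NegMemClass.coe_neg]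
    abel
  have hJ := lintegral_gauss_pos μ hQ.continuous (2 * s + 2 * s)
  have hJ' := lintegral_gauss_lt_top μ hQ (show 0 < 2 * s + 2 * s by positivity)
  rw [← ENNReal.mul_le_mul_iff_right hJ.ne' hJ'.ne, ← thetaShift_zero, key, key]
  have hneg : ∀ x, H (0 - x) = H x := fun x ↦ by rw [zero_sub, hH, hQ.thetaShift_neg]
  have hsq0 := hsq 0
  simp only [hneg] at hsq0 ⊢
  have two : (2 : ℝ≥0∞) ≠ 0 := by simp
  rw [← ENNReal.mul_le_mul_iff_right two ENNReal.ofNat_ne_top]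
  calc 2 * ∫⁻ x in ZSpan.fundamentalDomain b, H x * H (z - x) ∂μ
      = ∫⁻ x in ZSpan.fundamentalDomain b, 2 * (H x * H (z - x)) ∂μ :=
        (lintegral_const_mul _ (hHm.mul (hm z))).symm
    _ ≤ ∫⁻ x in ZSpan.fundamentalDomain b, H x * H x + H (z - x) * H (z - x) ∂μ :=
        lintegral_mono fun x ↦ two_mul_mul_le_ennreal _ _
    _ = 2 * ∫⁻ x in ZSpan.fundamentalDomain b, H x * H x ∂μ := by
        rw [lintegral_add_left (f := fun x ↦ H x * H x) (hHm.mul hHm), hsq z, ← hsq0, two_mul]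

lemma theta_scale (hQ : IsGaussForm Q) {s t : ℝ} (hs : 0 < s) (hst : s ≤ t) :
    theta b Q s ≤ ENNReal.ofReal ((t / s) ^ (Module.finrank ℝ V / 2 : ℝ)) * theta b Q t := by
  rcases hst.eq_or_lt with rfl | hst
  · simp [hs.ne']
  let μ : Measure V := Measure.addHaar
  have ht : 0 < t := hs.trans hst
  have hd : 0 < t - s := by linarith
  set r := s * t / (t - s) with hr
  have hr0 : 0 < r := by positivity
  have hrt : r + t = t ^ 2 / (t - s) := by rw [hr]; field_simp; ring
  have hrs : r * t / (r + t) = s := by rw [hrt, hr]; field_simp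
  have hG : ∀ s, Measurable (gauss Q s) := measurable_gauss hQ.continuous
  have key : (∫⁻ x, gauss Q (r + t) x ∂μ) * theta b Q s =
      ∫⁻ x, gauss Q r x * thetaShift b Q t (-x) ∂μ := by
    have : ∀ x, gauss Q r x * thetaShift b Q t (-x) = ∑' v : span ℤ (Set.range b),
          gauss Q r x * gauss Q t (v - x) := fun x ↦ by
      rw [thetaShift, ENNReal.tsum_mul_left]
      simp_rw [sub_eq_add_neg]
    simp_rw [this]
    have hm (v : span ℤ (Set.range b)) :
        Measurable fun x ↦ gauss Q r x * gauss Q t (v - x) :=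
      (hG r).mul ((hG t).comp (measurable_const.sub measurable_id))
    rw [lintegral_tsum fun v ↦ (hm v).aemeasurable]
    simp_rw [lintegral_gauss_conv μ hQ (show r + t ≠ 0 by positivity)]
    rw [ENNReal.tsum_mul_left, theta, hrs]
  have hle : (∫⁻ x, gauss Q (r + t) x ∂μ) * theta b Q s ≤
      (∫⁻ x, gauss Q r x ∂μ) * theta b Q t := by
    rw [key, ← lintegral_mul_const _ (hG r)]
    gcongr
    exact thetaShift_le hQ ht _
  have hJ := lintegral_gauss_pos μ hQ.continuous (r + t)
  have hJ' := lintegral_gauss_lt_top μ hQ (show 0 < r + t by positivity)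
  have hrel : ∫⁻ x, gauss Q r x ∂μ = (∫⁻ x, gauss Q (r + t) x ∂μ) *
      ENNReal.ofReal ((t / s) ^ (Module.finrank ℝ V / 2 : ℝ)) := by
    rw [lintegral_gauss_scale μ hQ hr0, lintegral_gauss_scale μ hQ (show 0 < r + t by positivity),
      mul_right_comm, ← ENNReal.ofReal_mul (by positivity)]
    congr 2
    rw [show t / s = (r + t) / r by rw [hrt, hr]; field_simp,
      Real.div_rpow (by positivity) hr0.le, Real.rpow_neg hr0.le, Real.rpow_neg (by positivity)]
    field_simp
  rwa [hrel, mul_assoc, ENNReal.mul_le_mul_iff_right hJ.ne' hJ'.ne] at hle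

lemma lintegral_gauss_eq_thetaShift (hQ : Continuous Q) (s : ℝ) :
    ∫⁻ x, gauss Q s x ∂μ = ∫⁻ x in ZSpan.fundamentalDomain b, thetaShift b Q s x ∂μ := by
  simpa [thetaShift] using lintegral_unfold (b := b) (g := fun _ ↦ 1) μ (measurable_gauss hQ s)
    measurable_const (fun _ _ ↦ rfl)

lemma lintegral_gauss_le_theta (hQ : IsGaussForm Q) {s : ℝ} (hs : 0 < s) :
    ∫⁻ x, gauss Q s x ∂μ ≤ theta b Q s * μ (ZSpan.fundamentalDomain b) := by
  rw [lintegral_gauss_eq_thetaShift (b := b) μ hQ.continuous, ← setLIntegral_const]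
  gcongr
  exact thetaShift_le hQ hs _

lemma theta_lt_top (hQ : IsGaussForm Q) {s : ℝ} (hs : 0 < s) : theta b Q s < ∞ := by
  let μ : Measure V := Measure.addHaar
  have h1 := lintegral_gauss_lt_top μ hQ (half_pos hs)
  rw [lintegral_gauss_eq_thetaShift (b := b) μ hQ.continuous] at h1
  have h2 := ae_lt_top (measurable_thetaShift hQ.continuous _) h1.ne
  have : NeZero (μ.restrict (ZSpan.fundamentalDomain b)) :=
    ⟨by simpa using ZSpan.measure_fundamentalDomain_ne_zero b⟩
  obtain ⟨z, hz⟩ := h2.exists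
  have hle : theta b Q s ≤ ENNReal.ofReal (Real.exp (s * Q z)) * thetaShift b Q (s / 2) z := by
    rw [theta, thetaShift, ← ENNReal.tsum_mul_left]
    refine ENNReal.tsum_le_tsum fun v ↦ ?_
    rw [gauss, gauss, ← ENNReal.ofReal_mul (Real.exp_pos _).le, ← Real.exp_add]
    refine ENNReal.ofReal_le_ofReal (Real.exp_le_exp.mpr ?_)
    have h3 := hQ.square 1 1 (-z) v (by norm_num)
    have h4 := hQ.square 1 1 (-v) z (by norm_num)
    have h5 := hQ.nonneg ((v : V) - (1 / (1 + 1) : ℝ) • ((v : V) + z))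
    have h6 := hQ.square 1 1 v (v + z) (by norm_num)
    rw [add_sub_cancel_left] at h6
    nlinarith
  exact hle.trans_lt (ENNReal.mul_lt_top ENNReal.ofReal_lt_top hz)

end GaussianLattice

section NumberFieldTheta

open NumberField.InfinitePlace NumberField.mixedEmbedding NumberField.Units
  NumberField.Units.dirichletUnitTheorem MeasureTheory Submodule Module
open scoped Classical ENNReal nonZeroDivisors

/-- The coordinates, indexed by all infinite places, of a point of the trace zero hyperplane
parametrised by the log space. -/
def logCoord (y : logSpace K) (w : InfinitePlace K) : ℝ :=
  if h : w = w₀ then -∑ v, y v else y ⟨w, h⟩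

lemma logCoord_add (y z : logSpace K) (w : InfinitePlace K) :
    logCoord (y + z) w = logCoord y w + logCoord z w := by
  unfold logCoord
  split_ifs
  · simp [Finset.sum_add_distrib, add_comm]
  · rfl

lemma logCoord_zero (w : InfinitePlace K) : logCoord (0 : logSpace K) w = 0 := by
  unfold logCoord
  split_ifs <;> simp

lemma sum_logCoord (y : logSpace K) : ∑ w, logCoord y w = 0 := by
  rw [Fintype.sum_eq_add_sum_subtype_ne _ w₀]
  have (v : {w : InfinitePlace K // w ≠ w₀}) : logCoord y v = y v := by
    simp [logCoord, v.2]
  simp_rw [this]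
  simp [logCoord]

lemma logCoord_restrict (c : InfinitePlace K → ℝ) (hc : ∑ w, c w = 0) (w : InfinitePlace K) :
    logCoord (fun v ↦ c v) w = c w := by
  rw [Fintype.sum_eq_add_sum_subtype_ne _ w₀] at hc
  unfold logCoord
  split_ifs with h
  · subst h
    linarith
  · rfl

/-- The scaling factors of the infinite places attached to a point of the log space. -/
def tau (y : logSpace K) (w : InfinitePlace K) : ℝ := Real.exp (logCoord y w / mult w)

lemma tau_pos (y : logSpace K) (w : InfinitePlace K) : 0 < tau y w := Real.exp_pos _

lemma tau_add (y z : logSpace K) (w : InfinitePlace K) :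
    tau (y + z) w = tau y w * tau z w := by
  rw [tau, tau, tau, ← Real.exp_add, logCoord_add, add_div]

lemma tau_zero (w : InfinitePlace K) : tau (0 : logSpace K) w = 1 := by
  simp [tau, logCoord_zero]

lemma tau_pow_mult (y : logSpace K) (w : InfinitePlace K) :
    tau y w ^ mult w = Real.exp (logCoord y w) := by
  rw [tau, ← Real.exp_nat_mul, mul_div_cancel₀ _ (by exact_mod_cast mult_coe_ne_zero)]

lemma prod_tau (y : logSpace K) : ∏ w, tau y w ^ mult w = 1 := by
  simp_rw [tau_pow_mult]
  rw [← Real.exp_sum, sum_logCoord, Real.exp_zero]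

lemma continuous_tau (w : InfinitePlace K) : Continuous fun y : logSpace K ↦ tau y w := by
  unfold tau logCoord
  split_ifs <;> fun_prop

/-- The quadratic form on the mixed space attached to a point of the log space. -/
def placeForm (y : logSpace K) (x : mixedSpace K) : ℝ :=
  ∑ w, tau y w ^ 2 * normAtPlace w x ^ 2

/-- The sum of the squares of the scaling factors. -/
def energy (y : logSpace K) : ℝ := ∑ w, tau y w ^ 2

lemma continuous_energy : Continuous (energy : logSpace K → ℝ) := by
  unfold energy
  exact continuous_finsetSum _ fun w _ ↦ (continuous_tau w).pow 2

lemma norm_sq_square {E : Type*} [NormedAddCommGroup E] [InnerProductSpace ℝ E] (a b : ℝ)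
    (x z : E) (h : a + b ≠ 0) :
    a * ‖x‖ ^ 2 + b * ‖z - x‖ ^ 2 =
      (a + b) * ‖x - (b / (a + b)) • z‖ ^ 2 + a * b / (a + b) * ‖z‖ ^ 2 := by
  rw [norm_sub_sq_real, norm_sub_sq_real, inner_smul_right, _root_.norm_smul, mul_pow,
    Real.norm_eq_abs, sq_abs, real_inner_comm x z]
  field_simp
  ring

omit [NumberField K] in
lemma normAtPlace_square (w : InfinitePlace K) (a b : ℝ) (x z : mixedSpace K) (h : a + b ≠ 0) :
    a * normAtPlace w x ^ 2 + b * normAtPlace w (z - x) ^ 2 =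
      (a + b) * normAtPlace w (x - (b / (a + b)) • z) ^ 2 +
        a * b / (a + b) * normAtPlace w z ^ 2 := by
  rcases isReal_or_isComplex w with hw | hw
  · simp_rw [normAtPlace_apply_of_isReal hw]
    exact norm_sq_square a b _ _ h
  · simp_rw [normAtPlace_apply_of_isComplex hw]
    exact norm_sq_square a b _ _ h

lemma isGaussForm_placeForm (y : logSpace K) : IsGaussForm (placeForm y) where
  continuous := by
    unfold placeForm
    exact continuous_finsetSum _ fun w _ ↦ ((continuous_normAtPlace w).pow 2).const_mul _
  smul c x := by
    simp_rw [placeForm, normAtPlace_smul, Finset.mul_sum, mul_pow, sq_abs]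
    exact Finset.sum_congr rfl fun _ _ ↦ by ring
  square a b x z h := by
    simp_rw [placeForm, Finset.mul_sum, ← Finset.sum_add_distrib]
    refine Finset.sum_congr rfl fun w _ ↦ ?_
    linear_combination tau y w ^ 2 * normAtPlace_square w a b x z h
  coercive := by
    obtain ⟨w₁, -, h₁⟩ := Finset.exists_min_image Finset.univ (fun w ↦ tau y w)
      Finset.univ_nonempty
    refine ⟨tau y w₁ ^ 2, pow_pos (tau_pos y w₁) 2, fun x ↦ ?_⟩
    obtain ⟨w, -, hw⟩ := Finset.exists_mem_eq_sup' Finset.univ_nonempty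
      fun w : InfinitePlace K ↦ normAtPlace w x
    rw [norm_eq_sup'_normAtPlace, hw]
    calc tau y w₁ ^ 2 * normAtPlace w x ^ 2 ≤ tau y w ^ 2 * normAtPlace w x ^ 2 := by
          have := h₁ w (Finset.mem_univ _)
          have := (tau_pos y w₁).le
          gcongr
      _ ≤ _ := Finset.single_le_sum (f := fun w ↦ tau y w ^ 2 * normAtPlace w x ^ 2)
          (fun _ _ ↦ by positivity) (Finset.mem_univ w)

/-- The normalised logarithmic vector of a nonzero element. -/
def logVec (α : K) : logSpace K := fun w ↦
  mult w.1 * (Real.log (w.1 α) - Real.log |(Algebra.norm ℚ α : ℚ)| / finrank ℚ K)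

lemma tau_logVec {α : K} (hα : α ≠ 0) (w : InfinitePlace K) :
    tau (logVec α) w * (|(Algebra.norm ℚ α : ℚ)| : ℝ) ^ (1 / finrank ℚ K : ℝ) = w α := by
  have hn : (finrank ℚ K : ℝ) ≠ 0 := by exact_mod_cast finrank_pos.ne'
  have hN : (0 : ℝ) < |((Algebra.norm ℚ α : ℚ) : ℝ)| := by
    simpa using hα
  have hw (w : InfinitePlace K) : 0 < w α := pos_iff.mpr hα
  have hm (w : InfinitePlace K) : (mult w : ℝ) ≠ 0 := mult_coe_ne_zero
  have h := logCoord_restrict (fun w : InfinitePlace K ↦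
    mult w * (Real.log (w α) - Real.log |(Algebra.norm ℚ α : ℚ)| / finrank ℚ K)) (by
    have h1 := congrArg Real.log (prod_eq_abs_norm α)
    rw [Real.log_prod (fun w _ ↦ (pow_pos (hw w) _).ne')] at h1
    simp_rw [Real.log_pow] at h1
    rw [Rat.cast_abs] at h1
    simp_rw [mul_sub, Finset.sum_sub_distrib, ← Finset.sum_mul]
    rw [h1, ← Nat.cast_sum, sum_mult_eq]
    field_simp
    ring) w
  rw [tau, show logCoord (logVec α) w = _ from h, mul_div_cancel_left₀ _ (hm w),
    Real.rpow_def_of_pos hN, ← Real.exp_add]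
  rw [show Real.log (w α) - Real.log |(Algebra.norm ℚ α : ℚ)| / finrank ℚ K +
    Real.log |(Algebra.norm ℚ α : ℚ)| * (1 / finrank ℚ K) = Real.log (w α) by ring,
    Real.exp_log (hw w)]

lemma placeForm_mixedEmbedding (y : logSpace K) {α : K} (hα : α ≠ 0) :
    placeForm y (mixedEmbedding K α) =
      (|(Algebra.norm ℚ α : ℚ)| : ℝ) ^ (2 / finrank ℚ K : ℝ) * energy (y + logVec α) := by
  rw [placeForm, energy, Finset.mul_sum]
  refine Finset.sum_congr rfl fun w _ ↦ ?_
  rw [normAtPlace_apply, ← tau_logVec hα w, tau_add, mul_pow _ (_ ^ _), ← Real.rpow_natCast (_ ^ _),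
    ← Real.rpow_mul (abs_nonneg _)]
  push_cast
  ring_nf

lemma placeForm_unit_mul (y : logSpace K) (u : (𝓞 K)ˣ) (α : K) :
    placeForm y (mixedEmbedding K ((u : K) * α)) =
      placeForm (y + logEmbedding K (Additive.ofMul u)) (mixedEmbedding K α) := by
  have hN : |((Algebra.norm ℚ (u : K) : ℚ) : ℝ)| = 1 := by
    rw [← Rat.cast_abs, Units.norm, Rat.cast_one]
  have h : logEmbedding K (Additive.ofMul u) = logVec (u : K) := by
    ext w
    rw [logVec, hN]
    simp
  rw [placeForm, placeForm]
  refine Finset.sum_congr rfl fun w _ ↦ ?_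
  have := tau_logVec (Units.coe_ne_zero u) w
  rw [normAtPlace_apply, map_mul, normAtPlace_apply, h, tau_add, ← this]
  rw [hN]
  simp only [Real.one_rpow, mul_one, mul_pow, mul_assoc]

variable (K) in
/-- The Mellin-type weight attached to an ideal norm. -/
def omega (r : ℝ) : ℝ≥0∞ := ∫⁻ y : logSpace K, gauss energy r y

lemma lintegral_gauss_placeForm (s : ℝ) {α : K} (hα : α ≠ 0) :
    ∫⁻ y : logSpace K, gauss (placeForm y) s (mixedEmbedding K α) =
      omega K (s * (|(Algebra.norm ℚ α : ℚ)| : ℝ) ^ (2 / finrank ℚ K : ℝ)) := by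
  simp_rw [omega, gauss, placeForm_mixedEmbedding _ hα]
  rw [lintegral_add_right_eq_self (fun y ↦ ENNReal.ofReal (Real.exp (-s *
    ((|(Algebra.norm ℚ α : ℚ)| : ℝ) ^ (2 / finrank ℚ K : ℝ) * energy y)))) (logVec α)]
  simp_rw [neg_mul, mul_assoc]

lemma finrank_le_two_mul_energy (y : logSpace K) : (finrank ℚ K : ℝ) ≤ 2 * energy y := by
  have h : ∀ w : InfinitePlace K, (mult w : ℝ) + 2 * logCoord y w ≤ 2 * tau y w ^ 2 := fun w ↦ by
    have h1 : 1 + 2 * (logCoord y w / mult w) ≤ tau y w ^ 2 := by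
      rw [tau, ← Real.exp_nat_mul]
      have := Real.add_one_le_exp ((2 : ℕ) * (logCoord y w / mult w))
      push_cast at this ⊢
      linarith
    have h2 : (mult w : ℝ) ≤ 2 := by
      unfold mult
      split_ifs <;> norm_num
    have h3 : (0 : ℝ) < mult w := by exact_mod_cast mult_pos
    calc (mult w : ℝ) + 2 * logCoord y w = mult w * (1 + 2 * (logCoord y w / mult w)) := by
          field_simp
      _ ≤ mult w * tau y w ^ 2 := by gcongr
      _ ≤ _ := by gcongr
  have h4 := Finset.sum_le_sum fun w (_ : w ∈ Finset.univ) ↦ h w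
  rw [Finset.sum_add_distrib, ← Finset.mul_sum, ← Finset.mul_sum, sum_logCoord, ← Nat.cast_sum,
    sum_mult_eq] at h4
  simpa [energy] using h4

lemma omega_pos (r : ℝ) : 0 < omega K r :=
  lintegral_gauss_pos _ continuous_energy r

/-- The sum of Gaussians over the nonzero elements of an ideal. -/
def idealTheta (A : (Ideal (𝓞 K))⁰) (y : logSpace K) (s : ℝ) : ℝ≥0∞ :=
  ∑' α : {α : 𝓞 K | α ∈ A.1 ∧ α ≠ 0}, gauss (placeForm y) s (mixedEmbedding K (α : 𝓞 K))

/-- The real basis of the mixed space given by an integral basis of an ideal. -/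
abbrev idealBasis (A : (Ideal (𝓞 K))⁰) := fractionalIdealLatticeBasis K (FractionalIdeal.mk0 K A)

lemma theta_idealBasis (A : (Ideal (𝓞 K))⁰) (y : logSpace K) (s : ℝ) :
    theta (idealBasis A) (placeForm y) s = 1 + idealTheta A y s := by
  have hmem (x : mixedSpace K) : x ∈ span ℤ (Set.range (idealBasis A)) ↔
      ∃ a ∈ A.1, mixedEmbedding K (a : 𝓞 K) = x := by
    rw [mem_span_fractionalIdealLatticeBasis, FractionalIdeal.coe_mk0]
    simp only [Set.mem_image, SetLike.mem_coe, FractionalIdeal.mem_coeIdeal]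
    constructor
    · rintro ⟨_, ⟨a, ha, rfl⟩, rfl⟩
      exact ⟨a, ha, rfl⟩
    · rintro ⟨a, ha, rfl⟩
      exact ⟨_, ⟨a, ha, rfl⟩, rfl⟩
  let f : {α : 𝓞 K | α ∈ A.1} → span ℤ (Set.range (idealBasis A)) := fun a ↦
    ⟨mixedEmbedding K (a : 𝓞 K), (hmem _).mpr ⟨a, a.2, rfl⟩⟩
  have hf : Function.Bijective f := by
    constructor
    · intro a b hab
      exact Subtype.ext (RingOfIntegers.coe_injective
        (mixedEmbedding_injective K (congrArg Subtype.val hab)))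
    · rintro ⟨x, hx⟩
      obtain ⟨a, ha, rfl⟩ := (hmem x).mp hx
      exact ⟨⟨a, ha⟩, rfl⟩
  rw [theta, ← (Equiv.ofBijective f hf).tsum_eq]
  simp only [Equiv.ofBijective_apply, f, idealTheta]
  rw [tsum_subtype {α : 𝓞 K | α ∈ A.1}
      (fun α : 𝓞 K ↦ gauss (placeForm y) s (mixedEmbedding K α)),
    tsum_subtype {α : 𝓞 K | α ∈ A.1 ∧ α ≠ 0}
      (fun α : 𝓞 K ↦ gauss (placeForm y) s (mixedEmbedding K α)),
    ENNReal.tsum_eq_add_tsum_ite 0]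
  congr 1
  · simp [gauss, (isGaussForm_placeForm y).zero]
  · refine tsum_congr fun α ↦ ?_
    by_cases h : α = 0 <;> simp [Set.indicator_apply, h]

lemma exp_neg_le_lintegral_gauss (y : logSpace K) :
    ENNReal.ofReal (Real.exp (-finrank ℚ K)) ≤ ∫⁻ x, gauss (placeForm y) 1 x := by
  let f : InfinitePlace K → NNReal := fun w ↦ ⟨(tau y w)⁻¹, (inv_pos.mpr (tau_pos y w)).le⟩
  have hvol : 1 ≤ volume (convexBodyLT K f) := by
    have hp : ∏ w, f w ^ mult w = 1 := by
      rw [← NNReal.coe_inj]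
      push_cast
      change ∏ w, (tau y w)⁻¹ ^ mult w = 1
      simp_rw [inv_pow]
      rw [Finset.prod_inv_distrib, prod_tau, inv_one]
    rw [convexBodyLT_volume, hp, ENNReal.coe_one, mul_one]
    exact_mod_cast one_le_convexBodyLTFactor K
  calc ENNReal.ofReal (Real.exp (-finrank ℚ K))
      ≤ ENNReal.ofReal (Real.exp (-finrank ℚ K)) * volume (convexBodyLT K f) :=
        le_mul_of_one_le_right' hvol
    _ = ∫⁻ x in convexBodyLT K f, ENNReal.ofReal (Real.exp (-finrank ℚ K)) :=
        (setLIntegral_const _ _).symm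
    _ ≤ ∫⁻ x in convexBodyLT K f, gauss (placeForm y) 1 x := by
        refine setLIntegral_mono (measurable_gauss (isGaussForm_placeForm y).continuous 1)
          fun x hx ↦ ENNReal.ofReal_le_ofReal (Real.exp_le_exp.mpr ?_)
        have hlt (w : InfinitePlace K) : normAtPlace w x ≤ (tau y w)⁻¹ := by
          simp only [convexBodyLT, Set.mem_prod, Set.mem_pi, Set.mem_univ, forall_true_left,
            mem_ball_zero_iff] at hx
          rcases isReal_or_isComplex w with hw | hw
          · rw [normAtPlace_apply_of_isReal hw]
            exact (hx.1 ⟨w, hw⟩).le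
          · rw [normAtPlace_apply_of_isComplex hw]
            exact (hx.2 ⟨w, hw⟩).le
        have hle : placeForm y x ≤ ∑ w : InfinitePlace K, (mult w : ℝ) := by
          refine Finset.sum_le_sum fun w _ ↦ ?_
          calc tau y w ^ 2 * normAtPlace w x ^ 2 ≤ tau y w ^ 2 * (tau y w)⁻¹ ^ 2 := by
                have := hlt w
                have := normAtPlace_nonneg w x
                gcongr
            _ = 1 := by
                rw [← mul_pow, mul_inv_cancel₀ (tau_pos y w).ne', one_pow]
            _ ≤ mult w := by exact_mod_cast mult_pos
        rw [← Nat.cast_sum, sum_mult_eq] at hle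
        linarith
    _ ≤ _ := setLIntegral_le_lintegral _ _

lemma volume_fundamentalDomain_idealBasis_le (A : (Ideal (𝓞 K))⁰) :
    volume (ZSpan.fundamentalDomain (idealBasis A)) ≤
      ENNReal.ofReal (Ideal.absNorm A.1 * Real.sqrt (discr K).natAbs) := by
  rw [volume_fundamentalDomain_fractionalIdealLatticeBasis,
    volume_fundamentalDomain_latticeBasis, FractionalIdeal.coe_mk0,
    FractionalIdeal.coeIdeal_absNorm, ENNReal.ofReal_mul (by positivity)]
  push_cast
  gcongr
  calc _ ≤ 1 * (NNReal.sqrt ‖discr K‖₊ : ℝ≥0∞) := by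
        gcongr
        exact pow_le_one₀ (by positivity) (by simp)
    _ = _ := by
        rw [one_mul, ← ENNReal.ofReal_coe_nnreal, Real.coe_sqrt]
        congr 2
        simp [Int.norm_eq_abs]

lemma absNorm_pos (A : (Ideal (𝓞 K))⁰) : 0 < (Ideal.absNorm A.1 : ℝ) := by
  have := Ideal.absNorm_ne_zero_of_nonZeroDivisors A
  positivity

/-- The Gaussian parameter at which the theta series of an ideal detects norms up to `x`. -/
def idealScale (A : (Ideal (𝓞 K))⁰) (x : ℝ) : ℝ :=
  (x * Ideal.absNorm A.1) ^ (-(2 / finrank ℚ K : ℝ))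

lemma idealScale_pos (A : (Ideal (𝓞 K))⁰) {x : ℝ} (hx : 0 < x) : 0 < idealScale A x :=
  Real.rpow_pos_of_pos (mul_pos hx (absNorm_pos A)) _

variable (K) in
/-- The threshold beyond which ideal theta series are dominated by their nonzero terms. -/
def threshold : ℝ := 2 * Real.exp (finrank ℚ K) * Real.sqrt (discr K).natAbs

lemma sqrt_discr_pos : 0 < Real.sqrt (discr K).natAbs := by
  have : (discr K).natAbs ≠ 0 := by simpa using discr_ne_zero K
  positivity

lemma threshold_pos : 0 < threshold K := by
  have := sqrt_discr_pos (K := K)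
  unfold threshold
  positivity

lemma two_le_theta (A : (Ideal (𝓞 K))⁰) (y : logSpace K) {x : ℝ} (hx : threshold K ≤ x) :
    2 ≤ theta (idealBasis A) (placeForm y) (idealScale A x) := by
  have hx0 : 0 < x := threshold_pos.trans_le hx
  have hN := absNorm_pos A
  have hs := idealScale_pos A hx0
  have hD := sqrt_discr_pos (K := K)
  have hn : (finrank ℚ K : ℝ) ≠ 0 := by exact_mod_cast finrank_pos.ne'
  have h1 := lintegral_gauss_le_theta (b := idealBasis A) volume (isGaussForm_placeForm y) hs
  rw [lintegral_gauss_scale volume (isGaussForm_placeForm y) hs, mixedEmbedding.finrank] at h1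
  have h2 : idealScale A x ^ (-(finrank ℚ K / 2 : ℝ)) = x * Ideal.absNorm A.1 := by
    rw [idealScale, ← Real.rpow_mul (by positivity),
      show -(2 / finrank ℚ K : ℝ) * -(finrank ℚ K / 2) = 1 by field_simp, Real.rpow_one]
  rw [h2] at h1
  have hd : 0 < Ideal.absNorm A.1 * Real.sqrt (discr K).natAbs := by positivity
  have h3 : 2 * ENNReal.ofReal (Ideal.absNorm A.1 * Real.sqrt (discr K).natAbs) ≤
      theta (idealBasis A) (placeForm y) (idealScale A x) *
        ENNReal.ofReal (Ideal.absNorm A.1 * Real.sqrt (discr K).natAbs) := by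
    calc _ ≤ ENNReal.ofReal (x * Ideal.absNorm A.1) *
          ENNReal.ofReal (Real.exp (-finrank ℚ K)) := by
          rw [← ENNReal.ofReal_mul (by positivity), ← ENNReal.ofReal_ofNat 2,
            ← ENNReal.ofReal_mul (by norm_num)]
          refine ENNReal.ofReal_le_ofReal ?_
          have : threshold K * Real.exp (-finrank ℚ K) = 2 * Real.sqrt (discr K).natAbs := by
            rw [threshold, mul_right_comm, mul_assoc 2, ← Real.exp_add, add_neg_cancel,
              Real.exp_zero, mul_one]
          calc _ = Ideal.absNorm A.1 * (threshold K * Real.exp (-finrank ℚ K)) := by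
                rw [this]; ring
            _ ≤ Ideal.absNorm A.1 * (x * Real.exp (-finrank ℚ K)) := by gcongr
            _ = _ := by ring
      _ ≤ _ := by
          refine le_trans (le_trans ?_ h1) ?_
          · gcongr
            exact exp_neg_le_lintegral_gauss y
          · gcongr
            exact volume_fundamentalDomain_idealBasis_le A
  rwa [ENNReal.mul_le_mul_iff_left (ENNReal.ofReal_pos.mpr hd).ne' ENNReal.ofReal_ne_top] at h3

lemma idealTheta_scale (A : (Ideal (𝓞 K))⁰) (y : logSpace K) {x c : ℝ} (hx : threshold K ≤ x)
    (hc : 1 ≤ c) : idealTheta A y (idealScale A (c * x)) ≤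
      ENNReal.ofReal (2 * c) * idealTheta A y (idealScale A x) := by
  have hx0 : 0 < x := threshold_pos.trans_le hx
  have hc0 : 0 < c := by linarith
  have hN := absNorm_pos A
  have hn : (finrank ℚ K : ℝ) ≠ 0 := by exact_mod_cast finrank_pos.ne'
  have h1 := two_le_theta A y hx
  rw [theta_idealBasis, ← one_add_one_eq_two] at h1
  have h1' : 1 ≤ idealTheta A y (idealScale A x) :=
    (ENNReal.add_le_add_iff_left ENNReal.one_ne_top).mp h1
  have hle : idealScale A (c * x) ≤ idealScale A x := by
    refine Real.rpow_le_rpow_of_nonpos (by positivity) ?_ (by simp; positivity)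
    gcongr
    nlinarith
  have h2 := theta_scale (b := idealBasis A) (isGaussForm_placeForm y)
    (idealScale_pos A (mul_pos hc0 hx0)) hle
  have h3 : (idealScale A x / idealScale A (c * x)) ^ (finrank ℝ (mixedSpace K) / 2 : ℝ) = c := by
    rw [mixedEmbedding.finrank, idealScale, idealScale, ← Real.div_rpow (by positivity)
      (by positivity), ← Real.rpow_mul (by positivity),
      show -(2 / finrank ℚ K : ℝ) * (finrank ℚ K / 2) = -1 by field_simp, Real.rpow_neg_one]
    field_simp
  rw [h3, theta_idealBasis, theta_idealBasis] at h2
  calc idealTheta A y (idealScale A (c * x)) ≤ 1 + idealTheta A y (idealScale A (c * x)) :=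
        le_add_self
    _ ≤ _ := h2
    _ ≤ ENNReal.ofReal c * (idealTheta A y (idealScale A x) + idealTheta A y (idealScale A x)) := by
        gcongr
    _ = _ := by
        rw [← two_mul, ← mul_assoc, mul_comm (ENNReal.ofReal c), ENNReal.ofReal_mul (by norm_num),
          ENNReal.ofReal_ofNat]

lemma tsum_comp_addMonoidHom {G H : Type*} [AddGroup G] [AddGroup H] (f : G →+ H)
    (h : H → ℝ≥0∞) : ∑' g, h (f g) = ENat.card f.ker * ∑' v : f.range, h v := by
  rw [← (Equiv.sigmaFiberEquiv f.rangeRestrict).tsum_eq, ENNReal.tsum_sigma',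
    ← ENNReal.tsum_mul_left]
  refine tsum_congr fun v ↦ ?_
  obtain ⟨_, g, rfl⟩ := v
  have hv (x : {x // f.rangeRestrict x = ⟨f g, ⟨g, rfl⟩⟩}) : h (f (Equiv.sigmaFiberEquiv
      f.rangeRestrict ⟨_, x⟩)) = h (f g) := congrArg h (congrArg Subtype.val x.2)
  simp_rw [hv]
  rw [ENNReal.tsum_const]
  congr 2
  refine ENat.card_congr (Equiv.trans (Equiv.subtypeEquivRight fun x ↦ ?_) (f.fiberEquivKer g))
  simp [Subtype.ext_iff]

instance countable_ringOfIntegers : Countable (𝓞 K) :=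
  (RingOfIntegers.basis K).repr.toEquiv.countable_iff.mpr inferInstance

instance countable_ideal : Countable (Ideal (𝓞 K)) :=
  Function.Surjective.countable (f := fun s : Finset (𝓞 K) ↦ Ideal.span (s : Set (𝓞 K)))
    fun I ↦ I.fg_of_isNoetherianRing

instance countable_unitLattice : Countable (unitLattice K) :=
  (basisUnitLattice K).repr.toEquiv.countable_iff.mpr inferInstance

variable (K) in
/-- A fundamental domain for the action of the units on the log space. -/
def unitDomain : Set (logSpace K) :=
  ZSpan.fundamentalDomain ((basisUnitLattice K).ofZLatticeBasis ℝ (unitLattice K))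

lemma tsum_units (h : logSpace K → ℝ≥0∞) :
    ∑' u : (𝓞 K)ˣ, h (logEmbedding K (Additive.ofMul u)) =
      ENat.card (torsion K) * ∑' v : unitLattice K, h v := by
  have h1 := tsum_comp_addMonoidHom (logEmbedding K) h
  rw [logEmbedding_ker] at h1
  rw [← Additive.ofMul.tsum_eq] at h1
  refine h1.trans ?_
  congr 1
  refine ((Equiv.setCongr ?_).tsum_eq (fun v : unitLattice K ↦ h v))
  ext
  simp [unitLattice]

lemma measurable_gauss_placeForm (s : ℝ) (x : mixedSpace K) :
    Measurable fun y : logSpace K ↦ gauss (placeForm y) s x := by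
  refine measurable_gauss (Q := fun y : logSpace K ↦ placeForm y x) ?_ s
  unfold placeForm
  exact continuous_finsetSum _ fun w _ ↦ ((continuous_tau w).pow 2).mul_const _

lemma setLIntegral_tsum_units (s : ℝ) {α : K} (hα : α ≠ 0) :
    ∫⁻ y in unitDomain K, ∑' u : (𝓞 K)ˣ, gauss (placeForm y) s (mixedEmbedding K ((u : K) * α)) =
      ENat.card (torsion K) *
        omega K (s * (|(Algebra.norm ℚ α : ℚ)| : ℝ) ^ (2 / finrank ℚ K : ℝ)) := by
  have hF := ZLattice.isAddFundamentalDomain (basisUnitLattice K)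
    (volume : Measure (logSpace K))
  have hm := measurable_gauss_placeForm s (mixedEmbedding K α)
  have hm' (v : unitLattice K) : Measurable fun y : logSpace K ↦
      gauss (placeForm (v +ᵥ y)) s (mixedEmbedding K α) :=
    hm.comp (measurable_const_add (v : logSpace K))
  have : VAddInvariantMeasure (unitLattice K) (logSpace K) volume :=
    ⟨fun v _ _ ↦ measure_preimage_add volume (v : logSpace K) _⟩
  rw [← lintegral_gauss_placeForm s hα, hF.lintegral_eq_tsum'',
    ← lintegral_tsum fun v ↦ (hm' v).aemeasurable,
    ← lintegral_const_mul _ (Measurable.tsum hm')]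
  refine lintegral_congr fun y ↦ ?_
  have := tsum_units fun z : logSpace K ↦ gauss (placeForm (y + z)) s (mixedEmbedding K α)
  simp_rw [gauss, placeForm_unit_mul] at this ⊢
  rw [this]
  congr 1
  refine tsum_congr fun v ↦ ?_
  rw [add_comm]
  rfl

/-- A generator of the product of `B` and `A`, when that product is principal. -/
lemma exists_generator (A : (Ideal (𝓞 K))⁰)
    (B : {B : (Ideal (𝓞 K))⁰ // ClassGroup.mk0 (B * A) = 1}) :
    ∃ g : 𝓞 K, Ideal.span {g} = B.1.1 * A.1 := by
  obtain ⟨g, hg⟩ := (ClassGroup.mk0_eq_one_iff (B.1 * A).2).mp B.2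
  exact ⟨g, hg.symm⟩

/-- The chosen generator. -/
def generator (A : (Ideal (𝓞 K))⁰)
    (B : {B : (Ideal (𝓞 K))⁰ // ClassGroup.mk0 (B * A) = 1}) : 𝓞 K :=
  (exists_generator A B).choose

lemma span_generator (A : (Ideal (𝓞 K))⁰)
    (B : {B : (Ideal (𝓞 K))⁰ // ClassGroup.mk0 (B * A) = 1}) :
    Ideal.span {generator A B} = B.1.1 * A.1 := (exists_generator A B).choose_spec

lemma generator_ne_zero (A : (Ideal (𝓞 K))⁰)
    (B : {B : (Ideal (𝓞 K))⁰ // ClassGroup.mk0 (B * A) = 1}) : generator A B ≠ 0 := by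
  intro h
  have h1 := span_generator A B
  rw [h, Ideal.span_singleton_eq_bot.mpr rfl] at h1
  exact nonZeroDivisors.ne_zero (B.1 * A).2 h1.symm

lemma abs_norm_generator (A : (Ideal (𝓞 K))⁰)
    (B : {B : (Ideal (𝓞 K))⁰ // ClassGroup.mk0 (B * A) = 1}) :
    (|(Algebra.norm ℚ (generator A B : K) : ℚ)| : ℝ) =
      Ideal.absNorm B.1.1 * Ideal.absNorm A.1 := by
  have h := congrArg Ideal.absNorm (span_generator A B)
  rw [Ideal.absNorm_span_singleton, map_mul] at h
  rw [← Algebra.coe_norm_int]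
  have h' := congrArg (Nat.cast (R := ℝ)) h
  rw [Nat.cast_natAbs] at h'
  push_cast at h' ⊢
  exact h'

lemma unit_mul_generator_mem (A : (Ideal (𝓞 K))⁰)
    (B : {B : (Ideal (𝓞 K))⁰ // ClassGroup.mk0 (B * A) = 1}) (u : (𝓞 K)ˣ) :
    (u : 𝓞 K) * generator A B ∈ A.1 ∧ (u : 𝓞 K) * generator A B ≠ 0 := by
  have h0 := generator_ne_zero A B
  have h : generator A B ∈ A.1 := by
    rw [← Ideal.span_singleton_le_iff_mem, span_generator]
    exact Ideal.mul_le_right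
  generalize generator A B = g at h h0 ⊢
  exact ⟨Ideal.mul_mem_left _ _ h, mul_ne_zero u.ne_zero h0⟩

/-- The parametrisation of the nonzero elements of an ideal by units and ideals. -/
def unitMulGenerator (A : (Ideal (𝓞 K))⁰)
    (p : {B : (Ideal (𝓞 K))⁰ // ClassGroup.mk0 (B * A) = 1} × (𝓞 K)ˣ) :
    {α : 𝓞 K | α ∈ A.1 ∧ α ≠ 0} :=
  ⟨p.2 * generator A p.1, unit_mul_generator_mem A p.1 p.2⟩

lemma bijective_unitMulGenerator (A : (Ideal (𝓞 K))⁰) :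
    Function.Bijective (unitMulGenerator A) := by
  have hA : A.1 ≠ 0 := nonZeroDivisors.ne_zero A.2
  constructor
  · rintro ⟨B, u⟩ ⟨B', u'⟩ h
    have h0 : (u : 𝓞 K) * generator A B = u' * generator A B' := congrArg Subtype.val h
    have h1 : Ideal.span {generator A B} = Ideal.span {generator A B'} := by
      rw [← Ideal.span_singleton_mul_left_unit u.isUnit, h0,
        Ideal.span_singleton_mul_left_unit u'.isUnit]
    rw [span_generator, span_generator] at h1
    obtain rfl : B = B' := Subtype.ext (Subtype.ext (mul_right_cancel₀ hA h1))
    rw [Units.ext (mul_right_cancel₀ (generator_ne_zero A B) h0)]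
  · rintro ⟨α, hα, hα0⟩
    obtain ⟨B, hB⟩ := Ideal.dvd_iff_le.mpr ((Ideal.span_singleton_le_iff_mem A.1).mpr hα)
    have hB0 : B ≠ 0 := by
      rintro rfl
      rw [mul_zero] at hB
      exact hα0 (Ideal.span_singleton_eq_bot.mp hB)
    let B' : (Ideal (𝓞 K))⁰ := ⟨B, mem_nonZeroDivisors_iff_ne_zero.mpr hB0⟩
    have hB' : ClassGroup.mk0 (B' * A) = 1 :=
      (ClassGroup.mk0_eq_one_iff (B' * A).2).mpr ⟨α, by
        rw [Ideal.submodule_span_eq, hB, mul_comm]; rfl⟩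
    have h1 := span_generator A ⟨B', hB'⟩
    rw [mul_comm, show A.1 * B'.1 = _ from hB.symm,
      Ideal.span_singleton_eq_span_singleton] at h1
    obtain ⟨u, hu⟩ := h1
    refine ⟨⟨⟨B', hB'⟩, u⟩, Subtype.ext ?_⟩
    exact (mul_comm _ _).trans hu

lemma lintegral_idealTheta (A : (Ideal (𝓞 K))⁰) {x : ℝ} (hx : 0 < x) :
    ∫⁻ y in unitDomain K, idealTheta A y (idealScale A x) = ENat.card (torsion K) *
      ∑' B : {B : (Ideal (𝓞 K))⁰ // ClassGroup.mk0 (B * A) = 1},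
        omega K ((Ideal.absNorm B.1.1 / x) ^ (2 / finrank ℚ K : ℝ)) := by
  have h1 (y : logSpace K) : idealTheta A y (idealScale A x) =
      ∑' B : {B : (Ideal (𝓞 K))⁰ // ClassGroup.mk0 (B * A) = 1}, ∑' u : (𝓞 K)ˣ,
        gauss (placeForm y) (idealScale A x) (mixedEmbedding K ((u : K) * generator A B)) := by
    rw [idealTheta, ← (Equiv.ofBijective _ (bijective_unitMulGenerator A)).tsum_eq,
      ← ENNReal.tsum_prod]
    simp [unitMulGenerator]
  simp_rw [h1]
  have : Countable (𝓞 K)ˣ := Units.val_injective.countable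
  rw [lintegral_tsum fun B ↦ (Measurable.tsum fun u ↦
    measurable_gauss_placeForm _ _).aemeasurable, ← ENNReal.tsum_mul_left]
  refine tsum_congr fun B ↦ ?_
  rw [setLIntegral_tsum_units _ (by simpa using generator_ne_zero A B), abs_norm_generator]
  congr 2
  have hA := absNorm_pos A
  have hB := absNorm_pos B.1
  rw [idealScale, Real.rpow_neg (by positivity), inv_mul_eq_div, ← Real.div_rpow (by positivity)
    (by positivity), mul_div_mul_right _ _ hA.ne']

variable (K) in
/-- The weight attached to a real number in place of an ideal norm. -/
def weight (t : ℝ) : ℝ≥0∞ := omega K (t ^ (2 / finrank ℚ K : ℝ))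

variable (K) in
/-- The weighted sum over all nonzero ideals, with weights concentrated on norms up to `x`. -/
def idealSum (x : ℝ) : ℝ≥0∞ := ∑' B : (Ideal (𝓞 K))⁰, weight K (Ideal.absNorm B.1 / x)

lemma mul_weight_le {t : ℝ} (ht : 0 < t) :
    ENNReal.ofReal t * weight K t ≤ weight K (t / 2 ^ (finrank ℚ K / 2 : ℝ)) := by
  have hn : (finrank ℚ K : ℝ) ≠ 0 := by exact_mod_cast finrank_pos.ne'
  rw [weight, weight, Real.div_rpow ht.le (by positivity), ← Real.rpow_mul (by norm_num),
    show (finrank ℚ K / 2 : ℝ) * (2 / finrank ℚ K) = 1 by field_simp, Real.rpow_one]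
  set r := t ^ (2 / finrank ℚ K : ℝ) with hr
  have hr0 : 0 < r := by positivity
  have htr : t = r ^ (finrank ℚ K / 2 : ℝ) := by
    rw [hr, ← Real.rpow_mul ht.le, show (2 / finrank ℚ K : ℝ) * (finrank ℚ K / 2) = 1 by
      field_simp, Real.rpow_one]
  have hexp : r ≤ Real.exp (r / 2) := by
    rw [show r / 2 = r / 4 + r / 4 by ring, Real.exp_add]
    nlinarith [Real.add_one_le_exp (r / 4), sq_nonneg (1 - r / 4)]
  have ht' : t ≤ Real.exp (r * finrank ℚ K / 4) := by
    calc t ≤ Real.exp (r / 2) ^ (finrank ℚ K / 2 : ℝ) := by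
          rw [htr]
          gcongr
      _ = _ := by
          rw [← Real.exp_mul]
          ring_nf
  rw [omega, omega, ← lintegral_const_mul _ (measurable_gauss continuous_energy _)]
  refine lintegral_mono fun y ↦ ?_
  rw [gauss, gauss, ← ENNReal.ofReal_mul ht.le]
  refine ENNReal.ofReal_le_ofReal ?_
  calc t * Real.exp (-r * energy y) ≤
      Real.exp (r * finrank ℚ K / 4) * Real.exp (-r * energy y) := by
        gcongr
    _ ≤ _ := by
        rw [← Real.exp_add]
        refine Real.exp_le_exp.mpr ?_
        nlinarith [finrank_le_two_mul_energy y]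

lemma torsion_mul_idealSum {A : ClassGroup (𝓞 K) → (Ideal (𝓞 K))⁰}
    (hA : ∀ c, ClassGroup.mk0 (A c) = c⁻¹) {x : ℝ} (hx : 0 < x) :
    ENat.card (torsion K) * idealSum K x =
      ∑' c, ∫⁻ y in unitDomain K, idealTheta (A c) y (idealScale (A c) x) := by
  simp_rw [lintegral_idealTheta _ hx]
  rw [ENNReal.tsum_mul_left, idealSum, ← (Equiv.sigmaFiberEquiv ClassGroup.mk0).tsum_eq,
    ENNReal.tsum_sigma']
  congr 1
  refine tsum_congr fun c ↦ ?_
  refine (Equiv.subtypeEquivRight fun B ↦ ?_).tsum_eq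
    (fun B : {B : (Ideal (𝓞 K))⁰ // ClassGroup.mk0 (B * A c) = 1} ↦
      weight K (Ideal.absNorm B.1.1 / x))
  rw [map_mul, hA, mul_inv_eq_one]

lemma exists_inverse_class_representatives :
    ∃ A : ClassGroup (𝓞 K) → (Ideal (𝓞 K))⁰, ∀ c, ClassGroup.mk0 (A c) = c⁻¹ :=
  ⟨fun c ↦ (ClassGroup.mk0_surjective c⁻¹).choose,
    fun c ↦ (ClassGroup.mk0_surjective c⁻¹).choose_spec⟩

omit [NumberField K] in
lemma card_torsion_ne_zero : (ENat.card (torsion K) : ℝ≥0∞) ≠ 0 := by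
  simp

lemma card_torsion_ne_top : (ENat.card (torsion K) : ℝ≥0∞) ≠ ∞ := by
  simp [ENat.card_eq_coe_natCard]

lemma idealSum_scale {x c : ℝ} (hx : threshold K ≤ x) (hc : 1 ≤ c) :
    idealSum K (c * x) ≤ ENNReal.ofReal (2 * c) * idealSum K x := by
  have hx0 : 0 < x := (threshold_pos (K := K)).trans_le hx
  obtain ⟨A, hA⟩ := exists_inverse_class_representatives (K := K)
  rw [← ENNReal.mul_le_mul_iff_right (card_torsion_ne_zero (K := K)) card_torsion_ne_top,
    torsion_mul_idealSum hA (by positivity), mul_left_comm, torsion_mul_idealSum hA hx0,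
    ← ENNReal.tsum_mul_left]
  refine ENNReal.tsum_le_tsum fun C ↦ ?_
  rw [← lintegral_const_mul' _ _ ENNReal.ofReal_ne_top]
  exact lintegral_mono fun y ↦ idealTheta_scale (A C) y hx hc

lemma isBounded_unitDomain : Bornology.IsBounded (unitDomain K) :=
  ZSpan.fundamentalDomain_isBounded _

lemma exists_le_tau : ∃ m > 0, ∀ y ∈ unitDomain K, ∀ w, m ≤ tau y w := by
  obtain ⟨R, hR⟩ := (isBounded_unitDomain (K := K)).subset_closedBall 0
  have hcont : Continuous fun y : logSpace K ↦ ∑ w, (tau y w)⁻¹ :=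
    continuous_finsetSum _ fun w _ ↦ (continuous_tau w).inv₀ fun y ↦ (tau_pos y w).ne'
  obtain ⟨M, hM⟩ := (isCompact_closedBall (0 : logSpace K) R).bddAbove_image hcont.continuousOn
  refine ⟨(max M 1)⁻¹, by positivity, fun y hy w ↦ ?_⟩
  refine inv_le_of_inv_le₀ (tau_pos y w) (le_max_of_le_left ?_)
  refine le_trans ?_ (hM ⟨y, hR hy, rfl⟩)
  exact Finset.single_le_sum (f := fun w ↦ (tau y w)⁻¹)
    (fun w _ ↦ (inv_pos.mpr (tau_pos y w)).le) (Finset.mem_univ w)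

lemma idealSum_lt_top {x : ℝ} (hx : 0 < x) : idealSum K x < ∞ := by
  obtain ⟨A, hA⟩ := exists_inverse_class_representatives (K := K)
  obtain ⟨m, hm, htau⟩ := exists_le_tau (K := K)
  have h : ENat.card (torsion K) * idealSum K x < ∞ := by
    rw [torsion_mul_idealSum hA hx, tsum_fintype]
    refine ENNReal.sum_lt_top.mpr fun c _ ↦ ?_
    have hs := idealScale_pos (A c) hx
    have hle : ∀ y ∈ unitDomain K, idealTheta (A c) y (idealScale (A c) x) ≤
        theta (idealBasis (A c)) (placeForm 0) (m ^ 2 * idealScale (A c) x) := fun y hy ↦ by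
      rw [theta_idealBasis]
      refine le_add_left (ENNReal.tsum_le_tsum fun α ↦ ENNReal.ofReal_le_ofReal
        (Real.exp_le_exp.mpr ?_))
      rw [neg_mul, neg_mul, neg_le_neg_iff, mul_right_comm, mul_comm (_ * _)]
      refine mul_le_mul_of_nonneg_left ?_ hs.le
      rw [placeForm, Finset.mul_sum]
      refine Finset.sum_le_sum fun w _ ↦ ?_
      rw [tau_zero, one_pow, one_mul]
      have := htau y hy w
      gcongr
    refine (setLIntegral_mono measurable_const hle).trans_lt ?_
    rw [setLIntegral_const]
    exact ENNReal.mul_lt_top (theta_lt_top (isGaussForm_placeForm 0) (by positivity))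
      isBounded_unitDomain.measure_lt_top
  exact ENNReal.lt_top_of_mul_ne_top_right h.ne card_torsion_ne_zero

lemma idealSum_pos (x : ℝ) : 0 < idealSum K x :=
  (omega_pos _).trans_le
    (ENNReal.le_tsum (f := fun B : (Ideal (𝓞 K))⁰ ↦ weight K (Ideal.absNorm B.1 / x)) 1)

lemma absNorm_ne_zero {I : Ideal (𝓞 K)} (hI : I ≠ 0) : Ideal.absNorm I ≠ 0 :=
  Ideal.absNorm_eq_zero_iff.not.mpr hI

lemma log_absNorm_nonneg (I : Ideal (𝓞 K)) : 0 ≤ Real.log (Ideal.absNorm I) :=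
  Real.log_natCast_nonneg _

lemma ΛK_nonneg (I : Ideal (𝓞 K)) : 0 ≤ ΛK K I := by
  unfold ΛK
  split_ifs
  · exact log_absNorm_nonneg _
  · exact le_rfl

lemma exists_prime_pow_of_ΛK_ne_zero {I : Ideal (𝓞 K)} (h : ΛK K I ≠ 0) :
    ∃ (p : Ideal (𝓞 K)) (k : ℕ), Prime p ∧ I = p ^ (k + 1) ∧
      ΛK K I = Real.log (Ideal.absNorm p) := by
  unfold ΛK at h ⊢
  split_ifs at h ⊢ with hI
  · obtain ⟨k, hp, hp0, hk, hIk⟩ := hI.choose_spec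
    refine ⟨hI.choose, k - 1, Ideal.prime_of_isPrime hp0 hp, ?_, rfl⟩
    rwa [Nat.sub_add_cancel hk]
  · exact absurd rfl h

lemma pow_dvd_of_prime_ne {p q I : Ideal (𝓞 K)} (hp : Prime p) (hq : Prime q) (hpq : q ≠ p)
    {k : ℕ} (h : q ^ k ∣ p * I) : q ^ k ∣ I := by
  refine hq.pow_dvd_of_dvd_mul_left k (fun hqp ↦ hpq ?_) h
  exact associated_iff_eq.mp (hq.associated_of_dvd hp hqp)

lemma sum_ΛK_dvd_le (D : Finset (Ideal (𝓞 K))) {I : Ideal (𝓞 K)} (hI : I ≠ 0) :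
    ∑ d ∈ D with d ∣ I, ΛK K d ≤ Real.log (Ideal.absNorm I) := by
  induction I using UniqueFactorizationMonoid.induction_on_prime with
  | h₁ => exact absurd rfl hI
  | h₂ I hu =>
    refine le_trans (Finset.sum_nonpos fun d hd ↦ ?_) (log_absNorm_nonneg I)
    by_contra! hlt
    obtain ⟨p, k, hp, rfl, -⟩ := exists_prime_pow_of_ΛK_ne_zero hlt.ne'
    have := isUnit_of_dvd_unit (Finset.mem_filter.mp hd).2 hu
    exact hp.not_isUnit ((isUnit_pow_succ_iff).mp this)
  | h₃ I p hI0 hp ih =>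
    rw [map_mul, Nat.cast_mul, Real.log_mul (by exact_mod_cast absNorm_ne_zero hp.ne_zero)
        (by exact_mod_cast absNorm_ne_zero hI0),
      add_comm, ← Finset.sum_filter_add_sum_filter_not _ (· ∣ I)]
    refine add_le_add ?_ ?_
    · refine le_trans (le_of_eq ?_) (ih hI0)
      rw [Finset.filter_filter]
      refine Finset.sum_congr (Finset.filter_congr fun d _ ↦ ?_) fun _ _ ↦ rfl
      exact ⟨fun h ↦ h.2, fun h ↦ ⟨h.mul_left p, h⟩⟩
    · rw [Finset.filter_filter]
      have key {d : Ideal (𝓞 K)} (hd : d ∣ p * I) (hd' : ¬ d ∣ I) (h0 : ΛK K d ≠ 0) :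
          ΛK K d = Real.log (Ideal.absNorm p) ∧ ∃ j, d = p ^ (j + 1) ∧ p ^ j ∣ I := by
        obtain ⟨q, j, hq, rfl, hΛ⟩ := exists_prime_pow_of_ΛK_ne_zero h0
        obtain rfl : q = p := by
          by_contra hqp
          exact hd' (pow_dvd_of_prime_ne hp hq hqp hd)
        refine ⟨hΛ, j, rfl, ?_⟩
        rwa [pow_succ', mul_dvd_mul_iff_left hq.ne_zero] at hd
      by_cases hex : ∃ d, (d ∣ p * I ∧ ¬ d ∣ I) ∧ ΛK K d ≠ 0
      · obtain ⟨d, ⟨hd, hd'⟩, h0⟩ := hex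
        obtain ⟨hΛ, j, rfl, hj⟩ := key hd hd' h0
        rw [← hΛ, ← Finset.sum_filter_ne_zero]
        refine le_trans (Finset.sum_le_sum_of_subset_of_nonneg (t := {p ^ (j + 1)})
          (fun e he ↦ ?_) fun _ _ _ ↦ ΛK_nonneg _) (Finset.sum_singleton _ _).le
        obtain ⟨he, he0⟩ := Finset.mem_filter.mp he
        obtain ⟨-, he, he'⟩ := Finset.mem_filter.mp he
        obtain ⟨-, i, rfl, hi⟩ := key he he' he0
        rw [Finset.mem_singleton]
        congr 2
        refine le_antisymm ?_ ?_ <;> by_contra! hlt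
        · exact hd' ((pow_dvd_pow p hlt).trans hi)
        · exact he' ((pow_dvd_pow p hlt).trans hj)
      · refine le_trans (Finset.sum_nonpos fun d hd ↦ ?_) (log_absNorm_nonneg p)
        by_contra! hlt
        exact hex ⟨d, (Finset.mem_filter.mp hd).2, hlt.ne'⟩

lemma sum_ΛK_mul_idealSum_le (D : Finset (Ideal (𝓞 K))) (hD : ∀ d ∈ D, d ≠ 0) {x : ℝ} :
    ∑ d ∈ D, ENNReal.ofReal (ΛK K d) * idealSum K (x / Ideal.absNorm d) ≤
      ∑' I : (Ideal (𝓞 K))⁰, ENNReal.ofReal (Real.log (Ideal.absNorm I.1)) *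
        weight K (Ideal.absNorm I.1 / x) := by
  have h1 : ∀ d ∈ D, idealSum K (x / Ideal.absNorm d) ≤
      ∑' I : (Ideal (𝓞 K))⁰, if d ∣ I.1 then weight K (Ideal.absNorm I.1 / x) else 0 :=
      fun d hd ↦ by
    let d' : (Ideal (𝓞 K))⁰ := ⟨d, mem_nonZeroDivisors_iff_ne_zero.mpr (hD d hd)⟩
    have hinj : Function.Injective fun B : (Ideal (𝓞 K))⁰ ↦ d' * B := fun B B' h ↦
      Subtype.ext (mul_left_cancel₀ (hD d hd) (congrArg Subtype.val h))
    refine le_trans (le_of_eq ?_) (ENNReal.tsum_comp_le_tsum_of_injective hinj _)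
    refine tsum_congr fun B ↦ ?_
    have hd : d ∣ (d' * B).1 := dvd_mul_right d B.1
    have hN : Ideal.absNorm (d' * B).1 = Ideal.absNorm d * Ideal.absNorm B.1 := map_mul _ d B.1
    rw [if_pos hd, hN, Nat.cast_mul, div_div_eq_mul_div, mul_comm]
  calc _ ≤ ∑ d ∈ D, ENNReal.ofReal (ΛK K d) * ∑' I : (Ideal (𝓞 K))⁰,
        if d ∣ I.1 then weight K (Ideal.absNorm I.1 / x) else 0 :=
        Finset.sum_le_sum fun d hd ↦ mul_le_mul_right (h1 d hd) _
    _ = ∑' I : (Ideal (𝓞 K))⁰, ∑ d ∈ D, ENNReal.ofReal (ΛK K d) *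
        if d ∣ I.1 then weight K (Ideal.absNorm I.1 / x) else 0 := by
        simp_rw [← ENNReal.tsum_mul_left]
        exact (Summable.tsum_finsetSum fun _ _ ↦ ENNReal.summable).symm
    _ ≤ _ := by
        refine ENNReal.tsum_le_tsum fun I ↦ ?_
        simp_rw [mul_ite, mul_zero]
        rw [← Finset.sum_filter, ← Finset.sum_mul,
          ← ENNReal.ofReal_sum_of_nonneg fun d _ ↦ ΛK_nonneg d]
        gcongr
        exact sum_ΛK_dvd_le D (nonZeroDivisors.ne_zero I.2)

lemma tsum_log_mul_weight_le {x : ℝ} (hx : threshold K ≤ x) :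
    ∑' I : (Ideal (𝓞 K))⁰, ENNReal.ofReal (Real.log (Ideal.absNorm I.1)) *
        weight K (Ideal.absNorm I.1 / x) ≤
      (ENNReal.ofReal (Real.log (2 ^ (finrank ℚ K / 2 : ℝ) * x)) + 2) * idealSum K x := by
  have hx0 : 0 < x := (threshold_pos (K := K)).trans_le hx
  set M : ℝ := 2 ^ (finrank ℚ K / 2 : ℝ) with hM
  have hM1 : 1 ≤ M := Real.one_le_rpow (by norm_num) (by positivity)
  have hM0 : 0 < M := by linarith
  have hterm (I : (Ideal (𝓞 K))⁰) : ENNReal.ofReal (Real.log (Ideal.absNorm I.1)) *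
      weight K (Ideal.absNorm I.1 / x) ≤
      ENNReal.ofReal (Real.log (M * x)) * weight K (Ideal.absNorm I.1 / x) +
        ENNReal.ofReal M⁻¹ * weight K (Ideal.absNorm I.1 / (M * x)) := by
    have hI := absNorm_pos I
    have h1 := Real.log_le_sub_one_of_pos (show 0 < Ideal.absNorm I.1 / (M * x) by positivity)
    rw [Real.log_div (by positivity) (by positivity)] at h1
    have h2 : Real.log (Ideal.absNorm I.1) ≤
        Real.log (M * x) + M⁻¹ * (Ideal.absNorm I.1 / x) := by
      have : M⁻¹ * (Ideal.absNorm I.1 / x) = Ideal.absNorm I.1 / (M * x) := by field_simp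
      linarith
    have h3 := mul_weight_le (K := K) (show 0 < Ideal.absNorm I.1 / x by positivity)
    rw [← hM, div_div, mul_comm x] at h3
    calc _ ≤ (ENNReal.ofReal (Real.log (M * x)) +
          ENNReal.ofReal M⁻¹ * ENNReal.ofReal (Ideal.absNorm I.1 / x)) *
            weight K (Ideal.absNorm I.1 / x) := by
          rw [← ENNReal.ofReal_mul (by positivity)]
          gcongr
          exact (ENNReal.ofReal_le_ofReal h2).trans ENNReal.ofReal_add_le
      _ ≤ _ := by
          rw [add_mul, mul_assoc]
          gcongr
  refine (ENNReal.tsum_le_tsum hterm).trans ?_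
  rw [ENNReal.tsum_add, ENNReal.tsum_mul_left, ENNReal.tsum_mul_left, add_mul]
  refine add_le_add le_rfl ?_
  calc ENNReal.ofReal M⁻¹ * idealSum K (M * x)
      ≤ ENNReal.ofReal M⁻¹ * (ENNReal.ofReal (2 * M) * idealSum K x) := by
        gcongr
        exact idealSum_scale hx hM1
    _ = 2 * idealSum K x := by
        rw [← mul_assoc, ← ENNReal.ofReal_mul (by positivity),
          show M⁻¹ * (2 * M) = 2 by field_simp, ENNReal.ofReal_ofNat]

lemma one_le_threshold : 1 ≤ threshold K := by
  have h1 : 1 ≤ Real.exp (finrank ℚ K) := Real.one_le_exp (by positivity)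
  have h2 : 1 ≤ Real.sqrt (discr K).natAbs := by
    rw [Real.one_le_sqrt]
    exact_mod_cast Nat.one_le_iff_ne_zero.mpr (by simpa using discr_ne_zero K)
  unfold threshold
  nlinarith

lemma sum_ΛK_div_absNorm_le {y : ℝ} (hy : 1 ≤ y) (D : Finset (Ideal (𝓞 K)))
    (hD : ∀ d ∈ D, d ≠ 0 ∧ (Ideal.absNorm d : ℝ) ≤ y) :
    ∑ d ∈ D, ΛK K d / Ideal.absNorm d ≤
      2 * (Real.log (2 ^ (finrank ℚ K / 2 : ℝ) * (threshold K * y)) + 2) := by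
  have hT := one_le_threshold (K := K)
  have hTx : threshold K ≤ threshold K * y := by nlinarith
  have hx0 : 0 < threshold K * y := by positivity
  have hM1 : (1 : ℝ) ≤ 2 ^ (finrank ℚ K / 2 : ℝ) := Real.one_le_rpow (by norm_num) (by positivity)
  have hlog : 0 ≤ Real.log (2 ^ (finrank ℚ K / 2 : ℝ) * (threshold K * y)) :=
    Real.log_nonneg (one_le_mul_of_one_le_of_one_le hM1 (hT.trans hTx))
  have h1 := (sum_ΛK_mul_idealSum_le D (fun d hd ↦ (hD d hd).1)).trans
    (tsum_log_mul_weight_le hTx)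
  have h2 : (∑ d ∈ D, ENNReal.ofReal (ΛK K d / (2 * Ideal.absNorm d))) *
      idealSum K (threshold K * y) ≤
      ∑ d ∈ D, ENNReal.ofReal (ΛK K d) * idealSum K (threshold K * y / Ideal.absNorm d) := by
    rw [Finset.sum_mul]
    refine Finset.sum_le_sum fun d hd ↦ ?_
    have hd1 : (1 : ℝ) ≤ Ideal.absNorm d := by
      exact_mod_cast Nat.one_le_iff_ne_zero.mpr (absNorm_ne_zero (hD d hd).1)
    have hd0 : (0 : ℝ) < Ideal.absNorm d := by linarith
    have h3 : threshold K ≤ threshold K * y / Ideal.absNorm d := by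
      rw [le_div_iff₀ hd0]
      have := (hD d hd).2
      gcongr
    have h4 := idealSum_scale h3 hd1
    rw [mul_div_cancel₀ _ hd0.ne'] at h4
    calc _ ≤ ENNReal.ofReal (ΛK K d / (2 * Ideal.absNorm d)) *
          (ENNReal.ofReal (2 * Ideal.absNorm d) *
            idealSum K (threshold K * y / Ideal.absNorm d)) := by gcongr
      _ = _ := by
          rw [← mul_assoc, ← ENNReal.ofReal_mul
            (div_nonneg (ΛK_nonneg d) (by positivity)), div_mul_cancel₀ _ (by positivity)]
  have h5 := (ENNReal.mul_le_mul_iff_left (idealSum_pos _).ne' (idealSum_lt_top hx0).ne).mp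
    (h2.trans h1)
  rw [← ENNReal.ofReal_sum_of_nonneg fun d _ ↦ div_nonneg (ΛK_nonneg d) (by positivity),
    ← ENNReal.ofReal_ofNat 2, ← ENNReal.ofReal_add hlog (by norm_num),
    ENNReal.ofReal_le_ofReal_iff (by positivity)] at h5
  have h6 : ∑ d ∈ D, ΛK K d / Ideal.absNorm d =
      2 * ∑ d ∈ D, ΛK K d / (2 * Ideal.absNorm d) := by
    rw [Finset.mul_sum]
    exact Finset.sum_congr rfl fun d _ ↦ by field_simp
  rw [h6]
  linarith

variable (K) in
lemma one_le_DK : (1 : ℝ) ≤ DK K := by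
  exact_mod_cast Nat.one_le_iff_ne_zero.mpr (by simpa [DK] using discr_ne_zero K)

variable (K) in
lemma finrank_le_log_DK : (finrank ℚ K : ℝ) ≤ 1 + 2 * Real.log (DK K) := by
  have hlog : 0 ≤ Real.log (DK K) := Real.log_nonneg (one_le_DK K)
  rcases (Nat.one_le_iff_ne_zero.mpr (finrank_pos (R := ℚ) (M := K)).ne').eq_or_lt with h | h
  · rw [← h, Nat.cast_one]
    linarith
  · have h1 := abs_discr_ge h
    have h2 : ((|discr K| : ℤ) : ℝ) = DK K := by
      rw [DK, Nat.cast_natAbs]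
    rw [h2] at h1
    have h3 : (4 / 9 : ℝ) * (9 / 4) ^ finrank ℚ K ≤ DK K := by
      refine le_trans ?_ h1
      gcongr
      linarith [Real.pi_gt_three]
    have h4 := Real.log_le_log (by positivity) h3
    rw [Real.log_mul (by norm_num) (by positivity), Real.log_pow,
      show (4 / 9 : ℝ) = (9 / 4)⁻¹ by norm_num, Real.log_inv] at h4
    have h5 : 1 / 2 ≤ Real.log (9 / 4) := by
      rw [Real.le_log_iff_exp_le (by norm_num)]
      have h6 : Real.exp (1 / 2) ^ 2 = Real.exp 1 := by
        rw [← Real.exp_nat_mul]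
        norm_num
      nlinarith [Real.exp_one_lt_d9, Real.exp_pos (1 / 2)]
    have h7 : (1 : ℝ) ≤ finrank ℚ K := by exact_mod_cast h.le
    nlinarith

lemma log_threshold_mul_le {y : ℝ} (hy : 2 ≤ y) :
    2 * (Real.log (2 ^ (finrank ℚ K / 2 : ℝ) * (threshold K * y)) + 2) ≤
      18 * Real.log ((DK K : ℝ) * y) := by
  have hD := one_le_DK K
  have hn := finrank_le_log_DK K
  have hlogD : 0 ≤ Real.log (DK K) := Real.log_nonneg hD
  have hlogy := Real.log_le_log (by norm_num) hy
  have h2 := Real.log_two_gt_d9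
  have h2' := Real.log_two_lt_d9
  have hT : Real.log (threshold K) =
      Real.log 2 + finrank ℚ K + Real.log (DK K) / 2 := by
    rw [threshold, Real.log_mul (by positivity) (sqrt_discr_pos).ne',
      Real.log_mul (by norm_num) (by positivity), Real.log_exp, Real.log_sqrt (by positivity), DK]
  rw [Real.log_mul (by positivity) (mul_pos threshold_pos (by positivity)).ne',
    Real.log_mul threshold_pos.ne' (by positivity), hT, Real.log_rpow (by norm_num),
    Real.log_mul (by positivity) (by positivity)]
  have hn0 : (0 : ℝ) ≤ finrank ℚ K := by positivity
  nlinarith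

end NumberFieldTheta

/-- **Prime ideal sum bound** (Lemma 2.10). For `y ≥ 2`,
`Σ_{N𝔫 ≤ y} Λ_K(𝔫)/N𝔫 ≪ log(D_K y)`. -/
theorem von_mangoldt_sum_bound :
    ∃ C : ℝ, 0 < C ∧
      ∀ (K : Type) [Field K] [NumberField K] (y : ℝ), 2 ≤ y →
        (∑' 𝔫 : {I : Ideal (𝓞 K) // I ≠ ⊥ ∧ (Ideal.absNorm I : ℝ) ≤ y},
            ΛK K 𝔫.1 / (Ideal.absNorm 𝔫.1 : ℝ)) ≤
          C * Real.log ((DK K : ℝ) * y) := by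
  refine ⟨18, by norm_num, fun K _ _ y hy ↦ ?_⟩
  have hlog : 0 ≤ Real.log ((DK K : ℝ) * y) :=
    Real.log_nonneg (one_le_mul_of_one_le_of_one_le (one_le_DK K) (by linarith))
  refine tsum_le_of_sum_le' (by positivity) fun s ↦ ?_
  have h := sum_ΛK_div_absNorm_le (show 1 ≤ y by linarith) (s.map (Function.Embedding.subtype _))
    fun d hd ↦ by
      obtain ⟨I, -, rfl⟩ := Finset.mem_map.mp hd
      exact I.2
  rw [Finset.sum_map] at h
  exact h.trans (log_threshold_mul_le hy)

end RTZ
end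
end
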